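/- Assume there exists x₀ ∈ ℝ^N such that ∫_{ℝ^N} ρ(y)·|x₀−y|^{-(N−α)} dy < ∞. Then the equation Δ^{α/2}u = ρ·φ(u) admits a nontrivial nonnegative entire bounded solution on ℝ^N. -/

import Mathlib

open MeasureTheory Real Filter Topology

noncomputable section

/-- The constant `c_{N,-α} = 2^α · π^{-N/2} · Γ((N+α)/2) / |Γ(-α/2)|`. -/
def fracLapCoeff (N : ℕ) (α : ℝ) : ℝ :=
  2 ^ α * Real.pi ^ (-(N : ℝ) / 2) * Real.Gamma (((N : ℝ) + α) / 2) / |Real.Gamma (-α / 2)|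

/-- The fractional Laplacian `Δ^{α/2}θ` of a test function `θ`. -/
def fracLap (N : ℕ) (α : ℝ) (θ : EuclideanSpace ℝ (Fin N) → ℝ)
    (x : EuclideanSpace ℝ (Fin N)) : ℝ :=
  (fracLapCoeff N α / 2) *
    ∫ z : EuclideanSpace ℝ (Fin N), (θ (x + z) + θ (x - z) - 2 * θ x) / ‖z‖ ^ ((N : ℝ) + α)

/-- A nonnegative entire bounded (distributional) solution of `Δ^{α/2}u = ρ·φ(u)` on `ℝ^N`. -/
def IsEntireSol (N : ℕ) (α : ℝ) (ρ : EuclideanSpace ℝ (Fin N) → ℝ) (φ : ℝ → ℝ)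
    (u : EuclideanSpace ℝ (Fin N) → ℝ) : Prop :=
  Continuous u ∧ (∃ M, ∀ x, u x ≤ M) ∧ (∀ x, 0 ≤ u x) ∧
  LocallyIntegrable (fun x => ρ x * φ (u x)) ∧
  ∀ θ : EuclideanSpace ℝ (Fin N) → ℝ, ContDiff ℝ (⊤ : ℕ∞) θ → HasCompactSupport θ →
    (∫ x, u x * fracLap N α θ x) = ∫ x, ρ x * φ (u x) * θ x

/-- Euclidean `N`-space. -/
abbrev Eucl (N : ℕ) := EuclideanSpace ℝ (Fin N)

/-- The (unnormalised) Riesz kernel `‖x‖^(α - N)`. -/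
def rieszKernel (N : ℕ) (α : ℝ) (x : Eucl N) : ℝ := ‖x‖ ^ (α - N)

section Kernel

variable {N : ℕ} {α : ℝ}

lemma rieszKernel_nonneg (x : Eucl N) : 0 ≤ rieszKernel N α x := by
  unfold rieszKernel; positivity

lemma rieszKernel_neg (x : Eucl N) : rieszKernel N α (-x) = rieszKernel N α x := by
  simp [rieszKernel]

lemma rieszKernel_sub_comm (x y : Eucl N) :
    rieszKernel N α (x - y) = rieszKernel N α (y - x) := by
  rw [← rieszKernel_neg, neg_sub]

@[fun_prop]
lemma measurable_rieszKernel : Measurable (rieszKernel N α) := by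
  unfold rieszKernel; fun_prop

lemma continuousAt_rieszKernel {x : Eucl N} (hx : x ≠ 0) : ContinuousAt (rieszKernel N α) x := by
  unfold rieszKernel
  exact continuousAt_id.norm.rpow_const (Or.inl (by simpa using hx))

lemma integrable_min_one_sq_div_rpow (hN : 3 ≤ N) (hα1 : 0 < α) (hα2 : α < 2) :
    Integrable (fun z : Eucl N => min 1 (‖z‖ ^ 2) / ‖z‖ ^ ((N : ℝ) + α)) := by
  have : Nontrivial (Eucl N) := by
    have : Nonempty (Fin N) := ⟨⟨0, by omega⟩⟩
    infer_instance
  rw [integrable_fun_norm_addHaar volume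
    (f := fun r : ℝ => min 1 (r ^ 2) / r ^ ((N : ℝ) + α))]
  simp only [finrank_euclideanSpace, Fintype.card_fin, smul_eq_mul]
  have key : ∀ r : ℝ, 0 < r → r ^ (N - 1) / r ^ ((N : ℝ) + α) = r ^ (-1 - α) := by
    intro r hr
    rw [← Real.rpow_natCast, ← Real.rpow_sub hr, Nat.cast_sub (by omega)]
    congr 1; push_cast; ring
  rw [← Set.Ioc_union_Ioi_eq_Ioi (zero_le_one (α := ℝ))]
  refine IntegrableOn.union ?_ ?_
  · have h : IntegrableOn (fun r : ℝ => r ^ (1 - α)) (Set.Ioc 0 1) := by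
      rw [← intervalIntegrable_iff_integrableOn_Ioc_of_le zero_le_one]
      exact intervalIntegral.intervalIntegrable_rpow' (by linarith)
    refine h.congr_fun (fun r hr => ?_) measurableSet_Ioc
    have hr0 : 0 < r := hr.1
    have h1 : r ^ 2 ≤ 1 := pow_le_one₀ hr0.le hr.2
    simp only [min_eq_right h1]
    rw [mul_div_assoc', mul_comm, mul_div_assoc, key r hr0, ← Real.rpow_natCast r 2,
      ← Real.rpow_add hr0]
    congr 1; push_cast; ring
  · have h : IntegrableOn (fun r : ℝ => r ^ (-1 - α)) (Set.Ioi 1) :=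
      integrableOn_Ioi_rpow_of_lt (by linarith) one_pos
    refine h.congr_fun (fun r hr => ?_) measurableSet_Ioi
    have hr1 : (1 : ℝ) < r := hr
    have hr0 : 0 < r := by linarith
    have h1 : 1 ≤ r ^ 2 := one_le_pow₀ hr1.le
    simp only [min_eq_left h1]
    rw [mul_one_div, key r hr0]

lemma integrableOn_rieszKernel_ball (hN : 3 ≤ N) (hα1 : 0 < α) (R : ℝ) :
    IntegrableOn (rieszKernel N α) (Metric.ball 0 R) := by
  have : Nontrivial (Eucl N) := by
    have : Nonempty (Fin N) := ⟨⟨0, by omega⟩⟩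
    infer_instance
  rcases le_or_gt R 0 with hR | hR
  · simp [Metric.ball_eq_empty.2 hR]
  unfold rieszKernel
  rw [integrableOn_fun_norm_addHaar volume (f := fun r : ℝ => r ^ (α - (N : ℝ)))]
  simp only [finrank_euclideanSpace, Fintype.card_fin, smul_eq_mul]
  have h : IntegrableOn (fun r : ℝ => r ^ (α - 1)) (Set.Ioo 0 R) := by
    rw [intervalIntegral.integrableOn_Ioo_rpow_iff hR]; linarith
  refine h.congr_fun (fun r hr => ?_) measurableSet_Ioo
  simp only
  rw [← Real.rpow_natCast, ← Real.rpow_add hr.1, Nat.cast_sub (by omega)]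
  congr 1; push_cast; ring

end Kernel

section SecondDifference

variable {N : ℕ} {α : ℝ}

/-- The symmetric second difference of `θ` at `x` with increment `z`. -/
def secondDiff (θ : Eucl N → ℝ) (x z : Eucl N) : ℝ := θ (x + z) + θ (x - z) - 2 * θ x

lemma fracLap_eq (θ : Eucl N → ℝ) (x : Eucl N) :
    fracLap N α θ x
      = fracLapCoeff N α / 2 * ∫ z, secondDiff θ x z / ‖z‖ ^ ((N : ℝ) + α) := rfl

lemma fracLapCoeff_pos (hα1 : 0 < α) (hα2 : α < 2) : 0 < fracLapCoeff N α := by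
  have h1 : 0 < Real.Gamma (((N : ℝ) + α) / 2) := Real.Gamma_pos_of_pos (by positivity)
  have h2 : Real.Gamma (-α / 2) ≠ 0 := by
    refine Real.Gamma_ne_zero fun m hm => ?_
    have hα : α = 2 * (m : ℝ) := by linarith
    rcases Nat.eq_zero_or_pos m with h | h
    · simp [h] at hα; linarith
    · have : (1 : ℝ) ≤ m := by exact_mod_cast h
      linarith
  have h3 : 0 < Real.pi ^ (-(N : ℝ) / 2) := Real.rpow_pos_of_pos Real.pi_pos _
  unfold fracLapCoeff
  positivity

lemma continuous_secondDiff {θ : Eucl N → ℝ} (hθ : Continuous θ) :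
    Continuous (fun p : Eucl N × Eucl N => secondDiff θ p.1 p.2) := by
  unfold secondDiff; fun_prop

lemma exists_abs_secondDiff_le_sq {θ : Eucl N → ℝ} (hθ : ContDiff ℝ (⊤ : ℕ∞) θ)
    (hc : HasCompactSupport θ) :
    ∃ C : ℝ, 0 ≤ C ∧ ∀ x z, |secondDiff θ x z| ≤ C * ‖z‖ ^ 2 := by
  have hd : ContDiff ℝ 1 (fderiv ℝ θ) := hθ.fderiv_right (by
    rw [one_add_one_eq_two]; exact WithTop.coe_le_coe.2 (le_top : (2 : ℕ∞) ≤ ⊤))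
  obtain ⟨K, hK⟩ := ContDiff.lipschitzWith_of_hasCompactSupport (hc.fderiv ℝ) hd one_ne_zero
  refine ⟨2 * K, by positivity, fun x z => ?_⟩
  have hdiff : Differentiable ℝ θ := hθ.differentiable (by simp)
  have hder : ∀ t ∈ Set.Icc (0 : ℝ) 1,
      HasDerivWithinAt (fun t : ℝ => θ (x + t • z) + θ (x - t • z))
        (fderiv ℝ θ (x + t • z) z - fderiv ℝ θ (x - t • z) z) (Set.Icc (0 : ℝ) 1) t := by
    intro t _
    have hl : HasDerivAt (fun t : ℝ => t • z) z t := by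
      simpa using (hasDerivAt_id t).smul_const z
    have h1 := (hdiff (x + t • z)).hasFDerivAt.comp_hasDerivAt t (hl.const_add x)
    have h2 := (hdiff (x - t • z)).hasFDerivAt.comp_hasDerivAt t (hl.const_sub x)
    have h3 := (h1.add h2).hasDerivWithinAt (s := Set.Icc (0 : ℝ) 1)
    simp only [map_neg] at h3
    exact h3
  have hb : ∀ t ∈ Set.Ico (0 : ℝ) 1,
      ‖fderiv ℝ θ (x + t • z) z - fderiv ℝ θ (x - t • z) z‖ ≤ 2 * K * ‖z‖ ^ 2 := by
    intro t ht
    rw [← sub_apply]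
    refine (ContinuousLinearMap.le_opNorm _ _).trans ?_
    have h1 := hK.norm_sub_le (x + t • z) (x - t • z)
    have h2 : ‖x + t • z - (x - t • z)‖ ≤ 2 * ‖z‖ := by
      have : x + t • z - (x - t • z) = (2 * t) • z := by rw [mul_smul, two_smul]; abel
      rw [this, norm_smul, Real.norm_eq_abs, abs_of_nonneg (by linarith [ht.1])]
      nlinarith [norm_nonneg z, ht.2]
    calc _ ≤ (K * (2 * ‖z‖)) * ‖z‖ := by gcongr; exact h1.trans (by gcongr)
      _ = _ := by ring
  have := norm_image_sub_le_of_norm_deriv_le_segment_01' hder hb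
  simp only [one_smul, zero_smul, add_zero, sub_zero, Real.norm_eq_abs] at this
  unfold secondDiff
  convert this using 2
  ring

lemma exists_abs_secondDiff_le {θ : Eucl N → ℝ} (hθ : ContDiff ℝ (⊤ : ℕ∞) θ)
    (hc : HasCompactSupport θ) :
    ∃ C : ℝ, 0 ≤ C ∧ ∀ x z, |secondDiff θ x z| ≤ C * min 1 (‖z‖ ^ 2) := by
  obtain ⟨C, hC, h⟩ := exists_abs_secondDiff_le_sq hθ hc
  obtain ⟨B, hB⟩ := hc.exists_bound_of_continuous hθ.continuous
  have hB0 : 0 ≤ B := (norm_nonneg _).trans (hB 0)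
  refine ⟨max C (4 * B), by positivity, fun x z => ?_⟩
  rw [mul_min_of_nonneg _ _ (by positivity)]
  refine le_min ?_ ((h x z).trans (by gcongr; exact le_max_left _ _))
  have h1 := hB (x + z)
  have h2 := hB (x - z)
  have h3 := hB x
  rw [Real.norm_eq_abs, abs_le] at h1 h2 h3
  refine le_trans ?_ ((le_max_right C (4 * B)).trans_eq (mul_one _).symm)
  rw [abs_le]; unfold secondDiff
  constructor <;> linarith

lemma integrable_secondDiff {θ : Eucl N → ℝ} (hθ : Continuous θ) (hc : HasCompactSupport θ)
    (z : Eucl N) : Integrable (fun x => secondDiff θ x z) := by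
  have h := hθ.integrable_of_hasCompactSupport (μ := volume) hc
  exact ((h.comp_add_right z).add (h.comp_sub_right z)).sub (h.const_mul 2)

lemma exists_integral_abs_secondDiff_le {θ : Eucl N → ℝ} (hθ : ContDiff ℝ (⊤ : ℕ∞) θ)
    (hc : HasCompactSupport θ) :
    ∃ C : ℝ, 0 ≤ C ∧ ∀ z, ∫ x, |secondDiff θ x z| ≤ C * min 1 (‖z‖ ^ 2) := by
  obtain ⟨C, hC, h⟩ := exists_abs_secondDiff_le_sq hθ hc
  obtain ⟨R, hR⟩ := hc.isCompact.isBounded.subset_closedBall (0 : Eucl N)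
  have hi := hθ.continuous.integrable_of_hasCompactSupport (μ := volume) hc
  set B := ∫ x, |θ x|
  set v := volume.real (Metric.closedBall (0 : Eucl N) (R + 1))
  have hB : 0 ≤ B := integral_nonneg fun x => abs_nonneg _
  have hv : 0 ≤ v := measureReal_nonneg
  have hfar : ∀ y : Eucl N, R < ‖y‖ → θ y = 0 := by
    intro y hy
    by_contra hne
    have := hR (subset_tsupport θ hne)
    rw [mem_closedBall_zero_iff] at this
    linarith
  refine ⟨max (C * v) (4 * B), by positivity, fun z => ?_⟩
  have hintg := (integrable_secondDiff hθ.continuous hc z).abs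
  rcases le_or_gt ‖z‖ 1 with hz | hz
  · have h1 : ‖z‖ ^ 2 ≤ 1 := pow_le_one₀ (norm_nonneg _) hz
    rw [min_eq_right h1]
    have hle : ∀ x, |secondDiff θ x z|
        ≤ (Metric.closedBall (0 : Eucl N) (R + 1)).indicator (fun _ => C * ‖z‖ ^ 2) x := by
      intro x
      by_cases hx : x ∈ Metric.closedBall (0 : Eucl N) (R + 1)
      · rw [Set.indicator_of_mem hx]; exact h x z
      · rw [Set.indicator_of_notMem hx]
        rw [mem_closedBall_zero_iff, not_le] at hx
        have e1 : θ (x + z) = 0 := hfar _ (by have := norm_sub_le (x + z) z; simp at this; linarith)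
        have e2 : θ (x - z) = 0 := hfar _ (by have := norm_add_le (x - z) z; simp at this; linarith)
        have e3 : θ x = 0 := hfar _ (by linarith)
        simp [secondDiff, e1, e2, e3]
    calc ∫ x, |secondDiff θ x z| ≤ ∫ x, (Metric.closedBall (0 : Eucl N) (R + 1)).indicator
          (fun _ => C * ‖z‖ ^ 2) x := by
          refine integral_mono hintg ?_ hle
          exact (integrable_indicator_iff measurableSet_closedBall).2
            (integrableOn_const (measure_closedBall_lt_top).ne)
      _ = v * (C * ‖z‖ ^ 2) := by
          rw [integral_indicator measurableSet_closedBall, setIntegral_const, smul_eq_mul]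
      _ = (C * v) * ‖z‖ ^ 2 := by ring
      _ ≤ _ := by gcongr; exact le_max_left _ _
  · have h1 : 1 ≤ ‖z‖ ^ 2 := one_le_pow₀ hz.le
    rw [min_eq_left h1, mul_one]
    refine le_trans ?_ (le_max_right _ _)
    have i1 := (hi.comp_add_right z).abs
    have i2 := (hi.comp_sub_right z).abs
    calc ∫ x, |secondDiff θ x z| ≤ ∫ x, (|θ (x + z)| + |θ (x - z)| + 2 * |θ x|) := by
          refine integral_mono hintg ((i1.add i2).add (hi.abs.const_mul 2)) fun x => ?_
          unfold secondDiff
          have := abs_sub (θ (x + z) + θ (x - z)) (2 * θ x)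
          have := abs_add_le (θ (x + z)) (θ (x - z))
          simp only [abs_mul, abs_two] at *
          linarith
      _ = 4 * B := by
          have i12 : Integrable (fun x => |θ (x + z)| + |θ (x - z)|) := i1.add i2
          rw [integral_add i12 (hi.abs.const_mul 2), integral_add i1 i2,
            integral_add_right_eq_self (fun x => |θ x|) z,
            integral_sub_right_eq_self (fun x => |θ x|) z, integral_const_mul]
          ring

lemma integrable_secondDiff_div (hN : 3 ≤ N) (hα1 : 0 < α) (hα2 : α < 2)
    {θ : Eucl N → ℝ} (hθ : ContDiff ℝ (⊤ : ℕ∞) θ)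
    (hc : HasCompactSupport θ) :
    Integrable (fun p : Eucl N × Eucl N => secondDiff θ p.1 p.2 / ‖p.2‖ ^ ((N : ℝ) + α))
      (volume.prod volume) := by
  obtain ⟨C, hC, h⟩ := exists_integral_abs_secondDiff_le hθ hc
  have hm : Measurable (fun p : Eucl N × Eucl N =>
      secondDiff θ p.1 p.2 / ‖p.2‖ ^ ((N : ℝ) + α)) :=
    (continuous_secondDiff hθ.continuous).measurable.div (by fun_prop)
  rw [integrable_prod_iff' hm.aestronglyMeasurable]
  refine ⟨Eventually.of_forall fun z => by
    simpa using (integrable_secondDiff hθ.continuous hc z).div_const (‖z‖ ^ ((N : ℝ) + α)), ?_⟩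
  refine ((integrable_min_one_sq_div_rpow hN hα1 hα2).const_mul C).mono' ?_ ?_
  · exact (hm.norm.stronglyMeasurable.integral_prod_left' (μ := volume)).aestronglyMeasurable
  · refine Eventually.of_forall fun z => ?_
    rw [Real.norm_of_nonneg (integral_nonneg fun _ => norm_nonneg _)]
    have hz : 0 ≤ ‖z‖ ^ ((N : ℝ) + α) := by positivity
    simp only [norm_div, Real.norm_eq_abs, abs_of_nonneg hz]
    rw [integral_div, ← mul_div_assoc]
    gcongr
    exact h z

lemma integrable_fracLap (hN : 3 ≤ N) (hα1 : 0 < α) (hα2 : α < 2)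
    {θ : Eucl N → ℝ} (hθ : ContDiff ℝ (⊤ : ℕ∞) θ)
    (hc : HasCompactSupport θ) : Integrable (fracLap N α θ) :=
  (integrable_secondDiff_div hN hα1 hα2 hθ hc).integral_prod_left.const_mul _

lemma exists_abs_fracLap_le (hN : 3 ≤ N) (hα1 : 0 < α) (hα2 : α < 2)
    {θ : Eucl N → ℝ} (hθ : ContDiff ℝ (⊤ : ℕ∞) θ)
    (hc : HasCompactSupport θ) : ∃ C : ℝ, ∀ x, |fracLap N α θ x| ≤ C := by
  obtain ⟨C, hC, h⟩ := exists_abs_secondDiff_le hθ hc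
  refine ⟨fracLapCoeff N α / 2 *
    ∫ z : Eucl N, C * (min 1 (‖z‖ ^ 2) / ‖z‖ ^ ((N : ℝ) + α)), fun x => ?_⟩
  have hk := fracLapCoeff_pos (N := N) hα1 hα2
  rw [fracLap_eq, abs_mul, abs_of_pos (by positivity)]
  gcongr
  rw [← Real.norm_eq_abs]
  refine norm_integral_le_of_norm_le
    ((integrable_min_one_sq_div_rpow hN hα1 hα2).const_mul C) (Eventually.of_forall fun z => ?_)
  have hz : 0 ≤ ‖z‖ ^ ((N : ℝ) + α) := by positivity
  rw [norm_div, Real.norm_eq_abs, Real.norm_eq_abs, abs_of_nonneg hz, ← mul_div_assoc]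
  gcongr
  exact h x z

end SecondDifference

section Symbol

open scoped FourierTransform RealInnerProductSpace

variable {N : ℕ} {α : ℝ}

/-- The Lévy–Khintchine integral `∫ (2 - 2 cos (2π⟪z, ξ⟫)) ‖z‖^(-(N+α)) dz`. -/
def levySymbol (N : ℕ) (α : ℝ) (ξ : Eucl N) : ℝ :=
  ∫ z : Eucl N, (2 - 2 * Real.cos (2 * π * ⟪z, ξ⟫)) / ‖z‖ ^ ((N : ℝ) + α)

lemma integrable_levySymbol (hN : 3 ≤ N) (hα1 : 0 < α) (hα2 : α < 2) (ξ : Eucl N) :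
    Integrable (fun z : Eucl N =>
      (2 - 2 * Real.cos (2 * π * ⟪z, ξ⟫)) / ‖z‖ ^ ((N : ℝ) + α)) := by
  set C := max 4 ((2 * π * ‖ξ‖) ^ 2)
  refine ((integrable_min_one_sq_div_rpow hN hα1 hα2).const_mul C).mono' ?_ ?_
  · exact (Measurable.div (by fun_prop) (by fun_prop)).aestronglyMeasurable
  · refine Eventually.of_forall fun z => ?_
    have hz : 0 ≤ ‖z‖ ^ ((N : ℝ) + α) := by positivity
    have h1 := Real.cos_le_one (2 * π * ⟪z, ξ⟫)
    have h2 := Real.neg_one_le_cos (2 * π * ⟪z, ξ⟫)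
    have h3 := Real.one_sub_sq_div_two_le_cos (x := 2 * π * ⟪z, ξ⟫)
    rw [norm_div, Real.norm_eq_abs, Real.norm_eq_abs, abs_of_nonneg hz, ← mul_div_assoc,
      abs_of_nonneg (by linarith)]
    gcongr
    rw [mul_min_of_nonneg _ _ (by positivity)]
    refine le_min ?_ ?_
    · have := le_max_left 4 ((2 * π * ‖ξ‖) ^ 2)
      simp only [C]; linarith
    · have h4 : (2 * π * ⟪z, ξ⟫) ^ 2 ≤ (2 * π * ‖ξ‖) ^ 2 * ‖z‖ ^ 2 := by
        rw [← mul_pow, ← sq_abs (2 * π * ⟪z, ξ⟫)]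
        have := abs_real_inner_le_norm z ξ
        refine pow_le_pow_left₀ (abs_nonneg _) ?_ 2
        rw [abs_mul, abs_of_pos (by positivity : 0 < 2 * π)]
        calc 2 * π * |⟪z, ξ⟫| ≤ 2 * π * (‖z‖ * ‖ξ‖) := by gcongr
          _ = _ := by ring
      calc _ ≤ (2 * π * ‖ξ‖) ^ 2 * ‖z‖ ^ 2 := by linarith
        _ ≤ _ := by gcongr; exact le_max_right _ _

lemma levySymbol_pos (hN : 3 ≤ N) (hα1 : 0 < α) (hα2 : α < 2) {ξ : Eucl N} (hξ : ξ ≠ 0) :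
    0 < levySymbol N α ξ := by
  have hnn : ∀ z : Eucl N, 0 ≤ (2 - 2 * Real.cos (2 * π * ⟪z, ξ⟫)) / ‖z‖ ^ ((N : ℝ) + α) := by
    intro z
    have h1 := Real.cos_le_one (2 * π * ⟪z, ξ⟫)
    have : 0 ≤ ‖z‖ ^ ((N : ℝ) + α) := by positivity
    exact div_nonneg (by linarith) this
  unfold levySymbol
  rw [integral_pos_iff_support_of_nonneg hnn (integrable_levySymbol hN hα1 hα2 ξ)]
  have ho : IsOpen {z : Eucl N | Real.cos (2 * π * ⟪z, ξ⟫) < 1 ∧ z ≠ 0} := by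
    have hcont : Continuous fun z : Eucl N => Real.cos (2 * π * ⟪z, ξ⟫) := by fun_prop
    exact (isOpen_lt hcont continuous_const).inter isOpen_ne
  have hξ' : ‖ξ‖ ≠ 0 := by simpa using hξ
  have hne : ({z : Eucl N | Real.cos (2 * π * ⟪z, ξ⟫) < 1 ∧ z ≠ 0}).Nonempty := by
    refine ⟨(1 / (2 * ‖ξ‖ ^ 2)) • ξ, ?_, ?_⟩
    · rw [inner_smul_left, real_inner_self_eq_norm_sq]
      have : 2 * π * ((starRingEnd ℝ) (1 / (2 * ‖ξ‖ ^ 2)) * ‖ξ‖ ^ 2) = π := by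
        simp only [conj_trivial]; field_simp
      rw [this, Real.cos_pi]; norm_num
    · simp [hξ]
  refine (ho.measure_pos volume hne).trans_le (measure_mono fun z hz => ?_)
  rw [Function.mem_support]
  have h1 : 0 < ‖z‖ := norm_pos_iff.2 hz.2
  have h2 := hz.1
  have : 0 < ‖z‖ ^ ((N : ℝ) + α) := by positivity
  exact (div_pos (by linarith) this).ne'

lemma levySymbol_smul {t : ℝ} (ht : 0 < t) (ξ : Eucl N) :
    levySymbol N α (t • ξ) = t ^ α * levySymbol N α ξ := by
  have h := Measure.integral_comp_smul_of_nonneg (volume : Measure (Eucl N))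
    (fun z : Eucl N => (2 - 2 * Real.cos (2 * π * ⟪z, ξ⟫)) / ‖z‖ ^ ((N : ℝ) + α)) t (hR := ht.le)
  simp only [finrank_euclideanSpace, Fintype.card_fin, smul_eq_mul] at h
  have e : ∀ z : Eucl N, (2 - 2 * Real.cos (2 * π * ⟪z, t • ξ⟫)) / ‖z‖ ^ ((N : ℝ) + α)
      = t ^ ((N : ℝ) + α) *
        ((2 - 2 * Real.cos (2 * π * ⟪t • z, ξ⟫)) / ‖t • z‖ ^ ((N : ℝ) + α)) := by
    intro z
    have : 0 < t ^ ((N : ℝ) + α) := Real.rpow_pos_of_pos ht _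
    rw [inner_smul_left, inner_smul_right, norm_smul, Real.norm_of_nonneg ht.le,
      Real.mul_rpow ht.le (norm_nonneg _)]
    simp only [conj_trivial]
    field_simp
  unfold levySymbol
  simp_rw [e]
  rw [integral_const_mul, h, ← mul_assoc]
  congr 1
  rw [Real.rpow_add ht, Real.rpow_natCast]
  field_simp

lemma levySymbol_eq_of_norm_eq {ξ η : Eucl N} (h : ‖ξ‖ = ‖η‖) :
    levySymbol N α ξ = levySymbol N α η := by
  set R : Eucl N ≃ₗᵢ[ℝ] Eucl N := (Submodule.reflection (ℝ ∙ (ξ - η))ᗮ)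
  have hR : R ξ = η := Submodule.reflection_sub h
  symm
  unfold levySymbol
  rw [← R.measurePreserving.integral_comp R.toHomeomorph.measurableEmbedding]
  simp only [R.norm_map, ← hR, R.inner_map_map]

lemma exists_levySymbol_eq (hN : 3 ≤ N) (hα1 : 0 < α) (hα2 : α < 2) :
    ∃ σ : ℝ, 0 < σ ∧ ∀ ξ : Eucl N, levySymbol N α ξ = σ * ‖ξ‖ ^ α := by
  set e : Eucl N := EuclideanSpace.single ⟨0, by omega⟩ 1
  have he : ‖e‖ = 1 := by simp [e]
  refine ⟨levySymbol N α e, levySymbol_pos hN hα1 hα2 (by rw [← norm_ne_zero_iff, he]; simp),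
    fun ξ => ?_⟩
  rcases eq_or_ne ξ 0 with rfl | hξ
  · simp [levySymbol, Real.zero_rpow hα1.ne']
  · have hn : 0 < ‖ξ‖ := norm_pos_iff.2 hξ
    rw [levySymbol_eq_of_norm_eq (η := ‖ξ‖ • e) (by simp [norm_smul, he]), levySymbol_smul hn,
      mul_comm]

lemma fourier_secondDiff {θ : Eucl N → ℝ} (hθ : Continuous θ) (hc : HasCompactSupport θ)
    (z ξ : Eucl N) :
    𝓕 (fun x => (secondDiff θ x z : ℂ)) ξ
      = -((2 - 2 * Real.cos (2 * π * ⟪z, ξ⟫) : ℝ) : ℂ) * 𝓕 (fun x => (θ x : ℂ)) ξ := by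
  have hi : Integrable (fun x => (θ x : ℂ)) :=
    (hθ.integrable_of_hasCompactSupport (μ := volume) hc).ofReal
  have shift : ∀ w : Eucl N, 𝓕 (fun x => (θ (x + w) : ℂ)) ξ
      = Complex.exp (2 * π * ⟪w, ξ⟫ * Complex.I) * 𝓕 (fun x => (θ x : ℂ)) ξ := by
    intro w
    have := congrFun (VectorFourier.fourierIntegral_comp_add_right Real.fourierChar volume
      (innerₗ (Eucl N)) (fun x => (θ x : ℂ)) w) ξ
    rw [Circle.smul_def, Real.fourierChar_apply] at this
    refine Eq.trans this ?_
    simp only [innerₗ_apply_apply, smul_eq_mul]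
    congr 2
    push_cast; ring
  have e : (fun x => (secondDiff θ x z : ℂ))
      = ((fun x => (θ (x + z) : ℂ)) + fun x => (θ (x + -z) : ℂ)) + (-2 : ℂ) • fun x => (θ x : ℂ) := by
    ext x; simp [secondDiff, sub_eq_add_neg]
  have i1 := hi.comp_add_right z
  have i2 := hi.comp_add_right (-z)
  have hadd : ∀ f g : Eucl N → ℂ, Integrable f → Integrable g → 𝓕 (f + g) ξ = 𝓕 f ξ + 𝓕 g ξ := by
    intro f g hf hg
    exact (congrFun (VectorFourier.fourierIntegral_add (L := innerₗ (Eucl N)) Real.continuous_fourierChar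
      (continuous_inner (𝕜 := ℝ) (E := Eucl N)) hf hg) ξ)
  have hsm : 𝓕 ((-2 : ℂ) • fun x => (θ x : ℂ)) ξ = -2 * 𝓕 (fun x => (θ x : ℂ)) ξ :=
    congrFun (VectorFourier.fourierIntegral_const_smul Real.fourierChar volume
      (innerₗ (Eucl N)) (fun x => (θ x : ℂ)) (-2)) ξ
  rw [e, hadd _ _ (i1.add i2) (hi.smul (-2 : ℂ)), hadd _ _ i1 i2, shift, shift, hsm]
  rw [inner_neg_left]
  push_cast
  rw [Complex.cos]
  ring_nf

lemma fourier_fracLap (hN : 3 ≤ N) (hα1 : 0 < α) (hα2 : α < 2)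
    {θ : Eucl N → ℝ} (hθ : ContDiff ℝ (⊤ : ℕ∞) θ) (hc : HasCompactSupport θ) (ξ : Eucl N) :
    𝓕 (fun x => (fracLap N α θ x : ℂ)) ξ
      = -((fracLapCoeff N α / 2 * levySymbol N α ξ : ℝ) : ℂ) * 𝓕 (fun x => (θ x : ℂ)) ξ := by
  have hintg := (integrable_secondDiff_div hN hα1 hα2 hθ hc).ofReal (𝕜 := ℂ)
  set e : Eucl N → ℂ := fun x => Complex.exp ((↑(-2 * π * ⟪x, ξ⟫) * Complex.I))
  have he : Continuous e := by fun_prop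
  have hen : ∀ x, ‖e x‖ = 1 := fun x => Complex.norm_exp_ofReal_mul_I _
  have hintg2 : Integrable (Function.uncurry fun x z : Eucl N =>
      e x * ((secondDiff θ x z / ‖z‖ ^ ((N : ℝ) + α) : ℝ) : ℂ)) (volume.prod volume) :=
    hintg.bdd_mul (c := 1) (he.comp continuous_fst).aestronglyMeasurable
      (Eventually.of_forall fun p => (hen _).le)
  have h1 : 𝓕 (fun x => (fracLap N α θ x : ℂ)) ξ = ((fracLapCoeff N α / 2 : ℝ) : ℂ) *
      ∫ x, ∫ z, e x * ((secondDiff θ x z / ‖z‖ ^ ((N : ℝ) + α) : ℝ) : ℂ) := by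
    rw [Real.fourier_eq', ← integral_const_mul]
    refine integral_congr_ae (Eventually.of_forall fun x => ?_)
    simp only [fracLap_eq, smul_eq_mul]
    rw [integral_const_mul, integral_complex_ofReal]
    simp only [e]
    push_cast; ring
  rw [h1, integral_integral_swap hintg2]
  have h2 : ∀ z : Eucl N, ∫ x, e x * ((secondDiff θ x z / ‖z‖ ^ ((N : ℝ) + α) : ℝ) : ℂ)
      = -(((2 - 2 * Real.cos (2 * π * ⟪z, ξ⟫)) / ‖z‖ ^ ((N : ℝ) + α) : ℝ) : ℂ)
        * 𝓕 (fun x => (θ x : ℂ)) ξ := by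
    intro z
    have := fourier_secondDiff hθ.continuous hc z ξ
    rw [Real.fourier_eq'] at this
    calc _ = (((‖z‖ ^ ((N : ℝ) + α))⁻¹ : ℝ) : ℂ) * ∫ x, e x • (secondDiff θ x z : ℂ) := by
          rw [← integral_const_mul]
          congr 1; ext x; simp only [smul_eq_mul]; push_cast; ring
      _ = _ := by rw [this]; push_cast; ring
  simp_rw [h2]
  rw [integral_mul_const, integral_neg, integral_complex_ofReal]
  unfold levySymbol
  push_cast; ring

lemma integral_fracLap_eq_zero (hN : 3 ≤ N) (hα1 : 0 < α) (hα2 : α < 2)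
    {θ : Eucl N → ℝ} (hθ : ContDiff ℝ (⊤ : ℕ∞) θ) (hc : HasCompactSupport θ) :
    ∫ x, fracLap N α θ x = 0 := by
  have h := fourier_fracLap hN hα1 hα2 hθ hc 0
  rw [Real.fourier_eq'] at h
  have h0 : levySymbol N α (0 : Eucl N) = 0 := by simp [levySymbol]
  simp only [inner_zero_right, mul_zero, Complex.ofReal_zero, zero_mul, Complex.exp_zero, one_smul,
    h0, neg_zero, integral_complex_ofReal] at h
  exact_mod_cast h

end Symbol

section Potential

open scoped FourierTransform RealInnerProductSpace

variable {N : ℕ} {α : ℝ}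

lemma integrable_rieszKernel_mul (hN : 3 ≤ N) (hα1 : 0 < α) (hα2 : α < 2) {g : Eucl N → ℝ}
    (hg : Integrable g) {M : ℝ} (hM : ∀ x, |g x| ≤ M) (y : Eucl N) :
    Integrable (fun x => rieszKernel N α (y - x) * g x) := by
  have hN' : (3 : ℝ) ≤ N := by exact_mod_cast hN
  have h1 : Integrable ((Metric.ball (0 : Eucl N) 1).indicator (rieszKernel N α)) :=
    (integrable_indicator_iff measurableSet_ball).2 (integrableOn_rieszKernel_ball hN hα1 1)
  refine (((h1.comp_sub_left y).const_mul M).add hg.abs).mono' ?_ (Eventually.of_forall fun x => ?_)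
  · exact (measurable_rieszKernel.comp (measurable_const.sub measurable_id)).aestronglyMeasurable.mul
      hg.aestronglyMeasurable
  · have hM0 : 0 ≤ M := (abs_nonneg _).trans (hM x)
    simp only [Pi.add_apply]
    rw [norm_mul, Real.norm_of_nonneg (rieszKernel_nonneg _), Real.norm_eq_abs]
    by_cases hx : y - x ∈ Metric.ball (0 : Eucl N) 1
    · rw [Set.indicator_of_mem hx]
      have := mul_le_mul_of_nonneg_left (hM x) (rieszKernel_nonneg (α := α) (y - x))
      linarith [abs_nonneg (g x)]
    · rw [Set.indicator_of_notMem hx, mul_zero, zero_add]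
      rw [mem_ball_zero_iff, not_lt] at hx
      exact mul_le_of_le_one_left (abs_nonneg _)
        (Real.rpow_le_one_of_one_le_of_nonpos hx (by linarith))

/-- The Fourier transform of the Gaussian `v ↦ exp (-t‖v‖²)`. -/
def gaussKernel (N : ℕ) (t : ℝ) (x : Eucl N) : ℝ :=
  (π / t) ^ ((N : ℝ) / 2) * Real.exp (-π ^ 2 * ‖x‖ ^ 2 / t)

lemma gaussKernel_nonneg {t : ℝ} (ht : 0 < t) (x : Eucl N) : 0 ≤ gaussKernel N t x := by
  unfold gaussKernel; positivity

lemma measurable_gaussKernel :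
    Measurable fun p : ℝ × Eucl N => gaussKernel N p.1 p.2 := by
  unfold gaussKernel; fun_prop

lemma fourier_gaussian_eq_gaussKernel {t : ℝ} (ht : 0 < t) (x w : Eucl N) :
    𝓕 (fun v : Eucl N => Complex.exp (-t * ‖v‖ ^ 2 + 2 * π * Complex.I * ⟪x, v⟫)) w
      = (gaussKernel N t (x - w) : ℂ) := by
  rw [fourier_gaussian_innerProductSpace' (by simpa)]
  simp only [finrank_euclideanSpace, Fintype.card_fin, gaussKernel]
  push_cast
  rw [Complex.ofReal_cpow (by positivity)]
  push_cast
  rfl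

lemma integral_gaussKernel (hN : 3 ≤ N) (hα2 : α < 2) :
    ∃ C : ℝ, 0 < C ∧ ∀ x : Eucl N, x ≠ 0 →
      IntegrableOn (fun t => t ^ (α / 2 - 1) * gaussKernel N t x) (Set.Ioi 0) ∧
      ∫ t in Set.Ioi 0, t ^ (α / 2 - 1) * gaussKernel N t x = C * rieszKernel N α x := by
  have hN' : (3 : ℝ) ≤ N := by exact_mod_cast hN
  have hb : 0 < ((N : ℝ) - α) / 2 := by linarith
  refine ⟨π ^ ((N : ℝ) / 2) * ((1 / π ^ 2) ^ (((N : ℝ) - α) / 2)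
    * Real.Gamma (((N : ℝ) - α) / 2)), ?_, fun x hx => ?_⟩
  · have := Real.Gamma_pos_of_pos hb
    positivity
  have hx' : 0 < ‖x‖ := norm_pos_iff.2 hx
  have hval : ∫ t in Set.Ioi 0, t ^ (α / 2 - 1) * gaussKernel N t x
      = π ^ ((N : ℝ) / 2) * ((1 / π ^ 2) ^ (((N : ℝ) - α) / 2)
        * Real.Gamma (((N : ℝ) - α) / 2)) * rieszKernel N α x := by
    have h1 := Real.integral_rpow_mul_exp_neg_mul_Ioi hb
      (by positivity : 0 < π ^ 2 * ‖x‖ ^ 2)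
    rw [← integral_comp_rpow_Ioi _ (by norm_num : (-1 : ℝ) ≠ 0)] at h1
    have h2 : ∫ t in Set.Ioi 0, t ^ (α / 2 - 1) * gaussKernel N t x
        = π ^ ((N : ℝ) / 2) * ∫ t in Set.Ioi 0, (|(-1 : ℝ)| * t ^ ((-1 : ℝ) - 1)) •
          ((t ^ (-1 : ℝ)) ^ (((N : ℝ) - α) / 2 - 1)
            * Real.exp (-(π ^ 2 * ‖x‖ ^ 2 * t ^ (-1 : ℝ)))) := by
      rw [← integral_const_mul]
      refine setIntegral_congr_fun measurableSet_Ioi fun t ht => ?_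
      have ht' : 0 < t := ht
      simp only [gaussKernel, smul_eq_mul, abs_neg, abs_one, one_mul]
      rw [Real.div_rpow Real.pi_pos.le ht'.le, ← Real.rpow_mul ht'.le, Real.rpow_neg_one]
      have e1 : t ^ ((-1 : ℝ) - 1) * t ^ (-1 * (((N : ℝ) - α) / 2 - 1))
          = t ^ (α / 2 - 1) / t ^ ((N : ℝ) / 2) := by
        rw [← Real.rpow_add ht', ← Real.rpow_sub ht']
        congr 1; ring
      calc _ = π ^ ((N : ℝ) / 2) * (t ^ (α / 2 - 1) / t ^ ((N : ℝ) / 2)) *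
            Real.exp (-π ^ 2 * ‖x‖ ^ 2 / t) := by ring
        _ = _ := by
            rw [← e1, show -π ^ 2 * ‖x‖ ^ 2 / t = -(π ^ 2 * ‖x‖ ^ 2 * t⁻¹) by
              rw [div_eq_mul_inv]; ring]
            ring
    rw [h2, h1, one_div, one_div, mul_inv, Real.mul_rpow (by positivity) (by positivity)]
    have e3 : (‖x‖ ^ 2)⁻¹ ^ (((N : ℝ) - α) / 2) = rieszKernel N α x := by
      rw [rieszKernel, ← Real.rpow_natCast, ← Real.rpow_neg hx'.le, ← Real.rpow_mul hx'.le]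
      congr 1; push_cast; ring
    rw [e3]; ring
  refine ⟨?_, hval⟩
  refine not_imp_comm.1 integral_undef ?_
  rw [hval]
  have := Real.Gamma_pos_of_pos hb
  have : 0 < rieszKernel N α x := Real.rpow_pos_of_pos hx' _
  positivity

lemma integral_gaussKernel_mul {t : ℝ} (ht : 0 < t) {g : Eucl N → ℂ} (hg : Integrable g)
    (y : Eucl N) :
    ∫ x, (gaussKernel N t (y - x) : ℂ) * g x
      = ∫ ξ : Eucl N, Complex.exp (-t * ‖ξ‖ ^ 2 + 2 * π * Complex.I * ⟪y, ξ⟫) * 𝓕 g ξ := by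
  have J : Integrable (fun w : Eucl N => Complex.exp (-t * ‖w‖ ^ 2 + 2 * π * Complex.I * ⟪y, w⟫)) :=
    GaussianFourier.integrable_cexp_neg_mul_sq_norm_add (by simpa) _ _
  simp_rw [← fourier_gaussian_eq_gaussKernel ht]
  simpa using! (VectorFourier.integral_fourierIntegral_smul_eq_flip (L := innerₗ (Eucl N))
      Real.continuous_fourierChar continuous_inner J hg)

/-- The Riesz kernel is, up to a positive constant, a fundamental solution of `-Δ^{α/2}`. -/
lemma exists_integral_rieszKernel_mul_fracLap (hN : 3 ≤ N) (hα1 : 0 < α) (hα2 : α < 2) :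
    ∃ κ : ℝ, 0 < κ ∧ ∀ θ : Eucl N → ℝ, ContDiff ℝ (⊤ : ℕ∞) θ → HasCompactSupport θ →
      ∀ y, ∫ x, rieszKernel N α (y - x) * fracLap N α θ x = -κ * θ y := by
  obtain ⟨C, hC, hCx⟩ := integral_gaussKernel hN hα2
  obtain ⟨σ, hσ, hS⟩ := exists_levySymbol_eq hN hα1 hα2
  have hk := fracLapCoeff_pos (N := N) hα1 hα2
  set c : ℝ := fracLapCoeff N α / 2 * σ with hc_def
  have hcpos : 0 < c := by positivity
  have ha : 0 < α / 2 := by positivity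
  have hΓ := Real.Gamma_pos_of_pos ha
  refine ⟨c * Real.Gamma (α / 2) / C, by positivity, fun θ hθ hc y => ?_⟩
  have hne : Nontrivial (Eucl N) := by
    have : Nonempty (Fin N) := ⟨⟨0, by omega⟩⟩
    infer_instance
  set g := fracLap N α θ
  have hg : Integrable g := integrable_fracLap hN hα1 hα2 hθ hc
  obtain ⟨B, hB⟩ := exists_abs_fracLap_le hN hα1 hα2 hθ hc
  have hΦg := integrable_rieszKernel_mul hN hα1 hα2 hg hB y
  -- the Schwartz function `θ`
  have hθc : HasCompactSupport (fun x => (θ x : ℂ)) :=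
    hc.comp_left (g := fun r : ℝ => (r : ℂ)) Complex.ofReal_zero
  have hθs : ContDiff ℝ (⊤ : ℕ∞) (fun x => (θ x : ℂ)) := Complex.ofRealCLM.contDiff.comp hθ
  set Θ : Eucl N → ℂ := fun x => (θ x : ℂ)
  have hΘi : Integrable (𝓕 Θ) := (𝓕 (hθc.toSchwartzMap hθs)).integrable
  have hΘi0 : Integrable Θ := (hθc.toSchwartzMap hθs).integrable
  have hinv : ∫ ξ, Complex.exp (2 * π * Complex.I * ⟪y, ξ⟫) * 𝓕 Θ ξ = Θ y := by
    rw [← congrFun (hθs.continuous.fourierInv_fourier_eq hΘi0 hΘi) y, Real.fourierInv_eq']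
    refine integral_congr_ae (Eventually.of_forall fun ξ => ?_)
    simp only [smul_eq_mul]
    rw [real_inner_comm]
    congr 2
    push_cast; ring
  -- left-hand side
  have hswap1 : Integrable (Function.uncurry fun (x : Eucl N) (t : ℝ) =>
      t ^ (α / 2 - 1) * gaussKernel N t (y - x) * g x)
      (volume.prod (volume.restrict (Set.Ioi 0))) := by
    have hm : AEStronglyMeasurable (Function.uncurry fun (x : Eucl N) (t : ℝ) =>
        t ^ (α / 2 - 1) * gaussKernel N t (y - x) * g x)
        (volume.prod (volume.restrict (Set.Ioi 0))) := by
      refine AEStronglyMeasurable.mul (Measurable.aestronglyMeasurable ?_)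
        hg.aestronglyMeasurable.comp_fst
      refine Measurable.mul (by fun_prop) ?_
      exact measurable_gaussKernel.comp
        (measurable_snd.prodMk (measurable_const.sub measurable_fst))
    rw [integrable_prod_iff hm]
    have hae : ∀ᵐ x : Eucl N, x ≠ y := by simp [ae_iff]
    constructor
    · filter_upwards [hae] with x hx
      exact (hCx (y - x) (sub_ne_zero.2 hx.symm)).1.mul_const (g x)
    · refine (hΦg.norm.const_mul C).congr ?_
      filter_upwards [hae] with x hx
      have h := (hCx (y - x) (sub_ne_zero.2 hx.symm)).2
      rw [norm_mul, ← mul_assoc, Real.norm_of_nonneg (rieszKernel_nonneg _), ← h,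
        ← integral_mul_const]
      refine setIntegral_congr_fun measurableSet_Ioi fun t ht => ?_
      have h1 := gaussKernel_nonneg ht (y - x)
      have h2 : 0 ≤ t ^ (α / 2 - 1) := Real.rpow_nonneg (le_of_lt ht) _
      simp only [Function.uncurry_apply_pair]
      rw [norm_mul _ (g x), Real.norm_of_nonneg (mul_nonneg h2 h1)]
  have hL : C * ∫ x, rieszKernel N α (y - x) * g x
      = ∫ t in Set.Ioi 0, t ^ (α / 2 - 1) * ∫ x, gaussKernel N t (y - x) * g x := by
    rw [← integral_const_mul]
    have hae : ∀ᵐ x : Eucl N, x ≠ y := by simp [ae_iff]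
    calc _ = ∫ x, ∫ t in Set.Ioi 0, t ^ (α / 2 - 1) * gaussKernel N t (y - x) * g x := by
          refine integral_congr_ae ?_
          filter_upwards [hae] with x hx
          rw [integral_mul_const, (hCx (y - x) (sub_ne_zero.2 hx.symm)).2, mul_assoc]
      _ = _ := by
          rw [integral_integral_swap hswap1]
          simp_rw [mul_assoc, integral_const_mul]
  -- right-hand side
  have hR1 : ∀ t : ℝ, 0 < t → ((∫ x, gaussKernel N t (y - x) * g x : ℝ) : ℂ)
      = ∫ ξ : Eucl N, -(c : ℂ) * (((‖ξ‖ ^ α * Real.exp (-(‖ξ‖ ^ 2 * t)) : ℝ) : ℂ) *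
          (Complex.exp (2 * π * Complex.I * ⟪y, ξ⟫) * 𝓕 Θ ξ)) := by
    intro t ht
    rw [← integral_complex_ofReal]
    push_cast
    refine (integral_gaussKernel_mul (g := fun x => (g x : ℂ)) ht hg.ofReal y).trans ?_
    refine integral_congr_ae (Eventually.of_forall fun ξ => ?_)
    simp only
    rw [fourier_fracLap hN hα1 hα2 hθ hc, hS, Complex.exp_add, hc_def]
    push_cast
    rw [show -(t : ℂ) * (‖ξ‖ : ℂ) ^ 2 = -((‖ξ‖ : ℂ) ^ 2 * t) by ring]
    ring
  have hΓint : ∀ ξ : Eucl N, ξ ≠ 0 →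
      IntegrableOn (fun t => t ^ (α / 2 - 1) * (‖ξ‖ ^ α * Real.exp (-(‖ξ‖ ^ 2 * t)))) (Set.Ioi 0) ∧
      ∫ t in Set.Ioi 0, t ^ (α / 2 - 1) * (‖ξ‖ ^ α * Real.exp (-(‖ξ‖ ^ 2 * t)))
        = Real.Gamma (α / 2) := by
    intro ξ hξ
    have hξ' : 0 < ‖ξ‖ := norm_pos_iff.2 hξ
    have hval : ∫ t in Set.Ioi 0, t ^ (α / 2 - 1) * (‖ξ‖ ^ α * Real.exp (-(‖ξ‖ ^ 2 * t)))
        = Real.Gamma (α / 2) := by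
      have h := Real.integral_rpow_mul_exp_neg_mul_Ioi ha (by positivity : 0 < ‖ξ‖ ^ 2)
      simp_rw [mul_left_comm _ (‖ξ‖ ^ α)]
      rw [integral_const_mul, h, one_div, ← mul_assoc]
      have : ‖ξ‖ ^ α * (‖ξ‖ ^ 2)⁻¹ ^ (α / 2) = 1 := by
        rw [← Real.rpow_natCast, ← Real.rpow_neg hξ'.le, ← Real.rpow_mul hξ'.le,
          ← Real.rpow_add hξ']
        convert Real.rpow_zero _ using 2
        push_cast; ring
      rw [this, one_mul]
    exact ⟨not_imp_comm.1 integral_undef (by rw [hval]; exact hΓ.ne'), hval⟩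
  set H : Eucl N → ℂ := fun ξ => Complex.exp (2 * π * Complex.I * ⟪y, ξ⟫) * 𝓕 Θ ξ with hH
  have hHi : Integrable H := by
    refine hΘi.bdd_mul (c := 1) (Continuous.aestronglyMeasurable (by fun_prop))
      (Eventually.of_forall fun ξ => ?_)
    rw [show 2 * (π : ℂ) * Complex.I * (⟪y, ξ⟫ : ℂ) = ((2 * π * ⟪y, ξ⟫ : ℝ) : ℂ) * Complex.I by
      push_cast; ring, Complex.norm_exp_ofReal_mul_I]
  have hae0 : ∀ᵐ ξ : Eucl N, ξ ≠ 0 := by simp [ae_iff]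
  have hswap2 : Integrable (Function.uncurry fun (ξ : Eucl N) (t : ℝ) =>
      ((t ^ (α / 2 - 1) * (‖ξ‖ ^ α * Real.exp (-(‖ξ‖ ^ 2 * t))) : ℝ) : ℂ) * H ξ)
      (volume.prod (volume.restrict (Set.Ioi 0))) := by
    have hm : AEStronglyMeasurable (Function.uncurry fun (ξ : Eucl N) (t : ℝ) =>
        ((t ^ (α / 2 - 1) * (‖ξ‖ ^ α * Real.exp (-(‖ξ‖ ^ 2 * t))) : ℝ) : ℂ) * H ξ)
        (volume.prod (volume.restrict (Set.Ioi 0))) := by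
      refine AEStronglyMeasurable.mul (Measurable.aestronglyMeasurable ?_)
        hHi.aestronglyMeasurable.comp_fst
      fun_prop
    rw [integrable_prod_iff hm]
    constructor
    · filter_upwards [hae0] with ξ hξ
      exact (hΓint ξ hξ).1.ofReal.mul_const (H ξ)
    · refine (hHi.norm.const_mul (Real.Gamma (α / 2))).congr ?_
      filter_upwards [hae0] with ξ hξ
      rw [← (hΓint ξ hξ).2, ← integral_mul_const]
      refine setIntegral_congr_fun measurableSet_Ioi fun t ht => ?_
      have h2 : 0 ≤ t ^ (α / 2 - 1) := Real.rpow_nonneg (le_of_lt ht) _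
      simp only [Function.uncurry_apply_pair]
      rw [norm_mul _ (H ξ), Complex.norm_real, Real.norm_of_nonneg (by positivity)]
  have hR : ((∫ t in Set.Ioi 0, t ^ (α / 2 - 1) * ∫ x, gaussKernel N t (y - x) * g x : ℝ) : ℂ)
      = -(c : ℂ) * (Real.Gamma (α / 2) * θ y) := by
    rw [← integral_complex_ofReal]
    calc _ = ∫ t in Set.Ioi (0 : ℝ), -(c : ℂ) * ∫ ξ : Eucl N,
          ((t ^ (α / 2 - 1) * (‖ξ‖ ^ α * Real.exp (-(‖ξ‖ ^ 2 * t))) : ℝ) : ℂ) * H ξ := by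
          refine setIntegral_congr_fun measurableSet_Ioi fun t ht => ?_
          simp only [Complex.ofReal_mul]
          rw [← Complex.ofReal_mul]
          rw [Complex.ofReal_mul, hR1 t ht, integral_const_mul, mul_left_comm,
            ← integral_const_mul]
          congr 2; ext ξ; push_cast; ring
      _ = -(c : ℂ) * ∫ ξ : Eucl N, ∫ t in Set.Ioi (0 : ℝ),
          ((t ^ (α / 2 - 1) * (‖ξ‖ ^ α * Real.exp (-(‖ξ‖ ^ 2 * t))) : ℝ) : ℂ) * H ξ := by
          rw [integral_const_mul, integral_integral_swap hswap2]
      _ = -(c : ℂ) * ∫ ξ : Eucl N, (Real.Gamma (α / 2) : ℂ) * H ξ := by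
          congr 1
          refine integral_congr_ae ?_
          filter_upwards [hae0] with ξ hξ
          rw [integral_mul_const, integral_complex_ofReal, (hΓint ξ hξ).2]
      _ = _ := by rw [integral_const_mul, hinv]
  have hfin : C * ∫ x, rieszKernel N α (y - x) * g x = -c * (Real.Gamma (α / 2) * θ y) := by
    rw [hL]; exact_mod_cast hR
  field_simp
  linarith

end Potential

section Admissible

open scoped NNReal

variable {N : ℕ} {α : ℝ} {μ : Measure (Eucl N)}

/-- The Riesz potential of the density `f` with respect to `μ`. -/
def rieszPot (N : ℕ) (α : ℝ) (μ : Measure (Eucl N)) (f : Eucl N → ℝ) (x : Eucl N) : ℝ :=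
  ∫ y, rieszKernel N α (x - y) * f y ∂μ

/-- A measure with locally bounded density whose Riesz potential is finite at some point. -/
structure IsAdmissible (N : ℕ) (α : ℝ) (μ : Measure (Eucl N)) : Prop where
  density_le : ∀ R : ℝ, ∃ M : ℝ≥0, μ.restrict (Metric.ball 0 R) ≤ M • volume
  exists_integrable : ∃ x₀, Integrable (fun y => rieszKernel N α (x₀ - y)) μ

lemma IsAdmissible.restrict (h : IsAdmissible N α μ) (s : Set (Eucl N)) :
    IsAdmissible N α (μ.restrict s) where
  density_le R := by
    obtain ⟨M, hM⟩ := h.density_le R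
    exact ⟨M, (Measure.restrict_mono_measure Measure.restrict_le_self _).trans hM⟩
  exists_integrable := by
    obtain ⟨x₀, hx₀⟩ := h.exists_integrable
    exact ⟨x₀, hx₀.restrict⟩

lemma integrableOn_rieszKernel_sub_ball (hN : 3 ≤ N) (hα1 : 0 < α) (x : Eucl N) (r : ℝ) :
    IntegrableOn (fun y => rieszKernel N α (x - y)) (Metric.ball x r) := by
  have h1 := ((integrable_indicator_iff measurableSet_ball).2
    (integrableOn_rieszKernel_ball (α := α) hN hα1 r)).comp_sub_left x
  rw [← integrable_indicator_iff measurableSet_ball]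
  refine h1.congr (Eventually.of_forall fun y => ?_)
  simp [Set.indicator, dist_eq_norm, norm_sub_rev]

lemma setIntegral_rieszKernel_sub_ball (x : Eucl N) (r : ℝ) :
    ∫ y in Metric.ball x r, rieszKernel N α (x - y)
      = ∫ y in Metric.ball (0 : Eucl N) r, rieszKernel N α y := by
  rw [← integral_indicator measurableSet_ball, ← integral_indicator measurableSet_ball,
    ← integral_sub_left_eq_self _ volume x]
  congr 1
  ext y
  simp [Set.indicator, dist_eq_norm]

lemma IsAdmissible.exists_ball_le (h : IsAdmissible N α μ) (hN : 3 ≤ N) (hα1 : 0 < α) (R : ℝ) :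
    ∃ M : ℝ, 0 ≤ M ∧ ∀ (x : Eucl N) (r : ℝ), Metric.ball x r ⊆ Metric.ball 0 R →
      IntegrableOn (fun y => rieszKernel N α (x - y)) (Metric.ball x r) μ ∧
      ∫ y in Metric.ball x r, rieszKernel N α (x - y) ∂μ
        ≤ M * ∫ y in Metric.ball (0 : Eucl N) r, rieszKernel N α y := by
  obtain ⟨M, hM⟩ := h.density_le R
  refine ⟨M, M.2, fun x r hr => ?_⟩
  have hle : μ.restrict (Metric.ball x r) ≤ M • volume.restrict (Metric.ball x r) := by
    rw [← Measure.restrict_smul, ← Measure.restrict_restrict_of_subset hr]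
    exact Measure.restrict_mono_measure hM _
  have hi : Integrable (fun y => rieszKernel N α (x - y)) (M • volume.restrict (Metric.ball x r)) :=
    Integrable.smul_measure_nnreal (integrableOn_rieszKernel_sub_ball hN hα1 x r)
  refine ⟨hi.mono_measure hle, (integral_mono_measure hle
    (Eventually.of_forall fun y => rieszKernel_nonneg _) hi).trans_eq ?_⟩
  rw [integral_smul_nnreal_measure, setIntegral_rieszKernel_sub_ball]
  rfl

lemma rieszKernel_le_of_norm_le_two_mul (hN : 3 ≤ N) (hα2 : α < 2) {x y : Eucl N} (hx : 0 < ‖x‖)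
    (hxy : ‖x‖ ≤ 2 * ‖y‖) : rieszKernel N α y ≤ 2 ^ ((N : ℝ) - α) * rieszKernel N α x := by
  have hN' : (3 : ℝ) ≤ N := by exact_mod_cast hN
  calc ‖y‖ ^ (α - N) ≤ (2⁻¹ * ‖x‖) ^ (α - N) :=
        Real.rpow_le_rpow_of_nonpos (by positivity) (by linarith) (by linarith)
    _ = _ := by
        rw [Real.mul_rpow (by norm_num) hx.le, Real.inv_rpow (by norm_num), ← Real.rpow_neg
          (by norm_num), neg_sub]
        rfl

lemma IsAdmissible.integrable (h : IsAdmissible N α μ) (hN : 3 ≤ N) (hα1 : 0 < α) (hα2 : α < 2)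
    (x : Eucl N) : Integrable (fun y => rieszKernel N α (x - y)) μ := by
  obtain ⟨x₀, hx₀⟩ := h.exists_integrable
  set r := 2 * ‖x - x₀‖ + 1
  obtain ⟨M, -, hM⟩ := h.exists_ball_le hN hα1 (‖x‖ + r)
  have hb := (hM x r (Metric.ball_subset_ball' (by simp [add_comm]))).1
  rw [← integrableOn_univ, ← Set.union_compl_self (Metric.ball x r)]
  refine hb.union ((hx₀.integrableOn.const_mul (2 ^ ((N : ℝ) - α))).mono'
    (measurable_rieszKernel.comp (measurable_const.sub measurable_id)).aestronglyMeasurable ?_)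
  refine ae_restrict_of_forall_mem measurableSet_ball.compl fun y hy => ?_
  rw [Set.mem_compl_iff, Metric.mem_ball, dist_comm, dist_eq_norm, not_lt] at hy
  rw [Real.norm_of_nonneg (rieszKernel_nonneg _)]
  have h1 : ‖x - y‖ ≤ ‖x - x₀‖ + ‖x₀ - y‖ := norm_sub_le_norm_sub_add_norm_sub _ _ _
  have h2 : ‖x₀ - y‖ ≤ ‖x - x₀‖ + ‖x - y‖ := by
    rw [norm_sub_rev x x₀]; exact norm_sub_le_norm_sub_add_norm_sub _ _ _
  have h3 := norm_nonneg (x - x₀)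
  exact rieszKernel_le_of_norm_le_two_mul hN hα2 (by linarith) (by linarith)

lemma tendsto_setIntegral_rieszKernel_ball (hN : 3 ≤ N) (hα1 : 0 < α) :
    Tendsto (fun r : ℝ => ∫ y in Metric.ball (0 : Eucl N) r, rieszKernel N α y)
      (𝓝[>] 0) (𝓝 0) := by
  have : Nonempty (Fin N) := ⟨⟨0, by omega⟩⟩
  have h1 := (integrableOn_rieszKernel_ball (N := N) (α := α) hN hα1 1)
  have hv : Tendsto (fun r : ℝ => volume (Metric.ball (0 : Eucl N) r)) (𝓝[>] 0) (𝓝 0) := by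
    simp_rw [EuclideanSpace.volume_ball]
    have h2 : Tendsto (fun r : ℝ => ENNReal.ofReal r ^ Fintype.card (Fin N)) (𝓝[>] 0) (𝓝 0) := by
      have : Tendsto (fun r : ℝ => ENNReal.ofReal r) (𝓝[>] 0) (𝓝 0) := by
        simpa using (ENNReal.continuous_ofReal.tendsto 0).mono_left nhdsWithin_le_nhds
      have h3 := ENNReal.Tendsto.pow (n := Fintype.card (Fin N)) this
      rwa [zero_pow (by simp; omega)] at h3
    simpa using ENNReal.Tendsto.mul_const h2 (Or.inr ENNReal.ofReal_ne_top)
  have hv' : Tendsto ((volume.restrict (Metric.ball (0 : Eucl N) 1)) ∘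
      fun r : ℝ => Metric.ball (0 : Eucl N) r) (𝓝[>] 0) (𝓝 0) :=
    tendsto_of_tendsto_of_tendsto_of_le_of_le tendsto_const_nhds hv (fun _ => zero_le)
      (fun r => Measure.restrict_apply_le _ _)
  refine (Integrable.tendsto_setIntegral_nhds_zero h1 hv').congr' ?_
  filter_upwards [Ioo_mem_nhdsGT (zero_lt_one' ℝ)] with r hr
  rw [Measure.restrict_restrict_of_subset (Metric.ball_subset_ball hr.2.le)]

lemma IsAdmissible.tendsto_integral_abs_sub (h : IsAdmissible N α μ) (hN : 3 ≤ N) (hα1 : 0 < α)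
    (hα2 : α < 2) (x : Eucl N) :
    Tendsto (fun x' => ∫ y, |rieszKernel N α (x' - y) - rieszKernel N α (x - y)| ∂μ)
      (𝓝 x) (𝓝 0) := by
  have hI := h.integrable hN hα1 hα2
  obtain ⟨M, hM0, hM⟩ := h.exists_ball_le hN hα1 (‖x‖ + 10)
  rw [Metric.tendsto_nhds]
  intro ε hε
  -- choice of the radius of the near region
  have hsm : ∀ᶠ r in 𝓝[>] (0 : ℝ),
      M * ∫ y in Metric.ball (0 : Eucl N) (3 * r), rieszKernel N α y < ε / 3 := by
    have h1 : Tendsto (fun r : ℝ => 3 * r) (𝓝[>] 0) (𝓝[>] 0) := by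
      refine tendsto_nhdsWithin_iff.2 ⟨?_, ?_⟩
      · simpa using ((continuous_const_mul (3 : ℝ)).tendsto 0).mono_left nhdsWithin_le_nhds
      · filter_upwards [self_mem_nhdsWithin] with r hr
        simpa using hr
    have h2 := ((tendsto_setIntegral_rieszKernel_ball (N := N) (α := α) hN hα1).comp h1).const_mul M
    rw [mul_zero] at h2
    exact h2.eventually (gt_mem_nhds (by positivity))
  obtain ⟨δ, hδ, hδ0, hδ1⟩ := (hsm.and (Ioo_mem_nhdsGT (zero_lt_one' ℝ))).exists
  set S := Metric.ball x (2 * δ)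
  -- the far region
  have hfar : Tendsto (fun x' => ∫ y in Sᶜ, |rieszKernel N α (x' - y) - rieszKernel N α (x - y)| ∂μ)
      (𝓝 x) (𝓝 (∫ y in Sᶜ, |rieszKernel N α (x - y) - rieszKernel N α (x - y)| ∂μ)) := by
    refine tendsto_integral_filter_of_dominated_convergence
      (fun y => (2 ^ ((N : ℝ) - α) + 1) * rieszKernel N α (x - y)) ?_ ?_ ?_ ?_
    · exact Eventually.of_forall fun x' => ((hI x').sub (hI x)).abs.aestronglyMeasurable.restrict
    · filter_upwards [Metric.ball_mem_nhds x hδ0] with x' hx'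
      refine ae_restrict_of_forall_mem measurableSet_ball.compl fun y hy => ?_
      rw [Set.mem_compl_iff, Metric.mem_ball, dist_comm, dist_eq_norm, not_lt] at hy
      rw [Metric.mem_ball, dist_comm, dist_eq_norm] at hx'
      have h1 : ‖x - y‖ ≤ ‖x - x'‖ + ‖x' - y‖ := norm_sub_le_norm_sub_add_norm_sub _ _ _
      have h2 := rieszKernel_le_of_norm_le_two_mul (α := α) (x := x - y) (y := x' - y) hN hα2
        (by linarith) (by linarith)
      have h3 := rieszKernel_nonneg (α := α) (x - y)
      have h4 := rieszKernel_nonneg (α := α) (x' - y)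
      rw [Real.norm_eq_abs, abs_abs]
      refine (abs_sub _ _).trans ?_
      rw [abs_of_nonneg h3, abs_of_nonneg h4]
      linarith
    · exact ((hI x).const_mul _).restrict
    · refine ae_restrict_of_forall_mem measurableSet_ball.compl fun y hy => ?_
      rw [Set.mem_compl_iff, Metric.mem_ball, dist_comm, dist_eq_norm, not_lt] at hy
      have hne : x - y ≠ 0 := norm_pos_iff.1 (by linarith)
      have h1 : Tendsto (fun x' => rieszKernel N α (x' - y)) (𝓝 x) (𝓝 (rieszKernel N α (x - y))) :=
        (continuousAt_rieszKernel hne).tendsto.comp ((continuous_sub_right y).tendsto x)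
      exact (h1.sub_const _).abs
  simp only [sub_self, abs_zero, integral_zero] at hfar
  filter_upwards [Metric.ball_mem_nhds x hδ0, hfar.eventually (gt_mem_nhds (by positivity :
    0 < ε / 3))] with x' hx' hfar'
  rw [dist_zero_right, Real.norm_of_nonneg (integral_nonneg fun y => abs_nonneg _)]
  rw [Metric.mem_ball] at hx'
  have hintg : Integrable (fun y => |rieszKernel N α (x' - y) - rieszKernel N α (x - y)|) μ :=
    ((hI x').sub (hI x)).abs
  have hsub : S ⊆ Metric.ball x (3 * δ) := Metric.ball_subset_ball (by linarith)
  have hsub' : S ⊆ Metric.ball x' (3 * δ) := Metric.ball_subset_ball' (by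
    rw [dist_comm] at hx'; linarith)
  have hx0 : dist x 0 = ‖x‖ := dist_zero_right x
  have hnear : ∀ z : Eucl N, dist z x < δ → S ⊆ Metric.ball z (3 * δ) →
      ∫ y in S, rieszKernel N α (z - y) ∂μ < ε / 3 := by
    intro z hz hs
    obtain ⟨h1, h2⟩ := hM z (3 * δ) (Metric.ball_subset_ball' (by
      have := dist_triangle z x 0; linarith))
    exact ((setIntegral_mono_set h1 (Eventually.of_forall fun y => rieszKernel_nonneg _)
      (Eventually.of_forall hs)).trans h2).trans_lt hδ
  have hn : ∫ y in S, |rieszKernel N α (x' - y) - rieszKernel N α (x - y)| ∂μ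
      ≤ (∫ y in S, rieszKernel N α (x' - y) ∂μ) + ∫ y in S, rieszKernel N α (x - y) ∂μ := by
    rw [← integral_add (hI x').integrableOn (hI x).integrableOn]
    refine integral_mono hintg.integrableOn ((hI x').integrableOn.add (hI x).integrableOn)
      fun y => (abs_sub _ _).trans_eq ?_
    rw [abs_of_nonneg (rieszKernel_nonneg _), abs_of_nonneg (rieszKernel_nonneg _)]
  rw [← integral_add_compl (measurableSet_ball : MeasurableSet S) hintg]
  have e1 := hnear x (by simpa using hδ0) hsub
  have e2 := hnear x' hx' hsub'
  linarith

lemma IsAdmissible.integrable_mul (h : IsAdmissible N α μ) (hN : 3 ≤ N) (hα1 : 0 < α)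
    (hα2 : α < 2) {f : Eucl N → ℝ} (hf : Measurable f) {M : ℝ} (hM : ∀ x, |f x| ≤ M)
    (x : Eucl N) : Integrable (fun y => rieszKernel N α (x - y) * f y) μ :=
  (h.integrable hN hα1 hα2 x).mul_bdd hf.aestronglyMeasurable (Eventually.of_forall hM)

lemma IsAdmissible.abs_rieszPot_le (h : IsAdmissible N α μ) (hN : 3 ≤ N) (hα1 : 0 < α)
    (hα2 : α < 2) {f : Eucl N → ℝ} {M : ℝ} (hM : ∀ x, |f x| ≤ M)
    (x : Eucl N) : |rieszPot N α μ f x| ≤ M * ∫ y, rieszKernel N α (x - y) ∂μ := by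
  rw [← integral_const_mul, ← Real.norm_eq_abs]
  refine norm_integral_le_of_norm_le ((h.integrable hN hα1 hα2 x).const_mul M)
    (Eventually.of_forall fun y => ?_)
  rw [norm_mul, Real.norm_of_nonneg (rieszKernel_nonneg _), mul_comm]
  exact mul_le_mul_of_nonneg_right (hM y) (rieszKernel_nonneg _)

lemma IsAdmissible.abs_rieszPot_sub_le (h : IsAdmissible N α μ) (hN : 3 ≤ N) (hα1 : 0 < α)
    (hα2 : α < 2) {f : Eucl N → ℝ} (hf : Measurable f) {M : ℝ} (hM : ∀ x, |f x| ≤ M)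
    (x x' : Eucl N) : |rieszPot N α μ f x' - rieszPot N α μ f x|
      ≤ M * ∫ y, |rieszKernel N α (x' - y) - rieszKernel N α (x - y)| ∂μ := by
  have hI := h.integrable hN hα1 hα2
  rw [rieszPot, rieszPot, ← integral_sub (h.integrable_mul hN hα1 hα2 hf hM x')
    (h.integrable_mul hN hα1 hα2 hf hM x), ← integral_const_mul, ← Real.norm_eq_abs]
  refine norm_integral_le_of_norm_le (((hI x').sub (hI x)).abs.const_mul M)
    (Eventually.of_forall fun y => ?_)
  rw [← sub_mul, norm_mul, mul_comm]
  exact mul_le_mul_of_nonneg_right (hM y) (abs_nonneg _)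

lemma IsAdmissible.continuous_rieszPot (h : IsAdmissible N α μ) (hN : 3 ≤ N) (hα1 : 0 < α)
    (hα2 : α < 2) {f : Eucl N → ℝ} (hf : Measurable f) {M : ℝ} (hM : ∀ x, |f x| ≤ M) :
    Continuous (rieszPot N α μ f) := by
  refine continuous_iff_continuousAt.2 fun x => tendsto_iff_dist_tendsto_zero.2 ?_
  refine squeeze_zero (fun _ => dist_nonneg)
    (fun x' => h.abs_rieszPot_sub_le hN hα1 hα2 hf hM x x') ?_
  simpa using (h.tendsto_integral_abs_sub hN hα1 hα2 x).const_mul M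

/-- Riesz potentials of a uniformly bounded sequence of densities have a pointwise convergent
subsequence. -/
lemma IsAdmissible.exists_subseq_tendsto (h : IsAdmissible N α μ) (hN : 3 ≤ N) (hα1 : 0 < α)
    (hα2 : α < 2) {f : ℕ → Eucl N → ℝ} (hf : ∀ k, Measurable (f k)) {M : ℝ}
    (hM : ∀ k x, |f k x| ≤ M) :
    ∃ s : ℕ → ℕ, StrictMono s ∧ ∃ p : Eucl N → ℝ,
      ∀ x, Tendsto (fun k => rieszPot N α μ (f (s k)) x) atTop (𝓝 (p x)) := by
  set D := TopologicalSpace.denseSeq (Eucl N)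
  set A : Eucl N → ℝ := fun x => M * ∫ y, rieszKernel N α (x - y) ∂μ
  have hcpt : IsCompact (Set.pi Set.univ fun i : ℕ => Set.Icc (-A (D i)) (A (D i))) :=
    isCompact_univ_pi fun i => isCompact_Icc
  obtain ⟨q, -, s, hs, hq⟩ := hcpt.tendsto_subseq
    (x := fun k i => rieszPot N α μ (f k) (D i)) (fun k i _ =>
      abs_le.1 (h.abs_rieszPot_le hN hα1 hα2 (hM k) (D i)))
  refine ⟨s, hs, ?_⟩
  have key : ∀ x, ∃ a, Tendsto (fun k => rieszPot N α μ (f (s k)) x) atTop (𝓝 a) := by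
    intro x
    refine cauchySeq_tendsto_of_complete (Metric.cauchySeq_iff.2 fun ε hε => ?_)
    have h1 : ∀ᶠ x' in 𝓝 x,
        M * ∫ y, |rieszKernel N α (x' - y) - rieszKernel N α (x - y)| ∂μ < ε / 3 := by
      have := (h.tendsto_integral_abs_sub hN hα1 hα2 x).const_mul M
      rw [mul_zero] at this
      exact this.eventually (gt_mem_nhds (by positivity))
    obtain ⟨i, hi⟩ := (TopologicalSpace.denseRange_denseSeq (Eucl N)).exists_mem_open
      isOpen_interior ⟨x, mem_interior_iff_mem_nhds.2 h1⟩
    replace hi := interior_subset hi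
    have hd : ∀ k, |rieszPot N α μ (f k) (D i) - rieszPot N α μ (f k) x| < ε / 3 := fun k =>
      (h.abs_rieszPot_sub_le hN hα1 hα2 (hf k) (hM k) x (D i)).trans_lt hi
    obtain ⟨n, hn⟩ := Metric.cauchySeq_iff.1 (tendsto_pi_nhds.1 hq i).cauchySeq (ε / 3)
      (by positivity)
    refine ⟨n, fun a ha b hb => ?_⟩
    have e1 := abs_lt.1 (hd (s a))
    have e2 := abs_lt.1 (hd (s b))
    have e3 := hn a ha b hb
    rw [Real.dist_eq] at e3 ⊢
    have e3 := abs_lt.1 e3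
    simp only [Function.comp_apply] at e3
    rw [abs_lt]
    constructor <;> linarith [e1.1, e1.2, e2.1, e2.2, e3.1, e3.2]
  choose p hp using key
  exact ⟨p, hp⟩

end Admissible

section Energy

variable {N : ℕ} {α : ℝ} {μ : Measure (Eucl N)}

lemma IsAdmissible.integral_one_sub_rieszPot_mul_fracLap (h : IsAdmissible N α μ) [SFinite μ]
    (hN : 3 ≤ N) (hα1 : 0 < α) (hα2 : α < 2) {κ : ℝ}
    (hκ : ∀ θ : Eucl N → ℝ, ContDiff ℝ (⊤ : ℕ∞) θ → HasCompactSupport θ →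
      ∀ y, ∫ x, rieszKernel N α (y - x) * fracLap N α θ x = -κ * θ y)
    {f : Eucl N → ℝ} (hf : Measurable f) {M : ℝ} (hf0 : ∀ x, 0 ≤ f x) (hM : ∀ x, f x ≤ M)
    {B : ℝ} (hB : ∀ x, rieszPot N α μ f x ≤ B) {θ : Eucl N → ℝ}
    (hθ : ContDiff ℝ (⊤ : ℕ∞) θ) (hc : HasCompactSupport θ) :
    ∫ x, (1 - rieszPot N α μ f x) * fracLap N α θ x = κ * ∫ y, f y * θ y ∂μ := by
  have hfM : ∀ x, |f x| ≤ M := fun x => by rw [abs_of_nonneg (hf0 x)]; exact hM x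
  have hI := h.integrable_mul hN hα1 hα2 hf hfM
  have hg := integrable_fracLap hN hα1 hα2 hθ hc
  have hpc := h.continuous_rieszPot hN hα1 hα2 hf hfM
  have hp0 : ∀ x, 0 ≤ rieszPot N α μ f x := fun x =>
    integral_nonneg fun y => mul_nonneg (rieszKernel_nonneg _) (hf0 y)
  have hpg : Integrable (fun x => rieszPot N α μ f x * fracLap N α θ x) :=
    hg.bdd_mul hpc.aestronglyMeasurable (Eventually.of_forall fun x => by
      rw [Real.norm_of_nonneg (hp0 x)]; exact hB x)
  have hF : Integrable (Function.uncurry fun x y : Eucl N =>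
      rieszKernel N α (x - y) * f y * fracLap N α θ x) (volume.prod μ) := by
    have hm : AEStronglyMeasurable (Function.uncurry fun x y : Eucl N =>
        rieszKernel N α (x - y) * f y * fracLap N α θ x) (volume.prod μ) := by
      refine AEStronglyMeasurable.mul (Measurable.aestronglyMeasurable ?_)
        hg.aestronglyMeasurable.comp_fst
      exact (measurable_rieszKernel.comp (measurable_fst.sub measurable_snd)).mul
        (hf.comp measurable_snd)
    rw [integrable_prod_iff hm]
    refine ⟨Eventually.of_forall fun x => (hI x).mul_const (fracLap N α θ x), ?_⟩
    refine hpg.norm.congr (Eventually.of_forall fun x => ?_)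
    simp only [Function.uncurry_apply_pair]
    rw [norm_mul, Real.norm_of_nonneg (hp0 x), rieszPot, ← integral_mul_const]
    congr 1
    ext y
    rw [norm_mul, Real.norm_of_nonneg (mul_nonneg (rieszKernel_nonneg _) (hf0 y))]
  have hswap : ∫ x, rieszPot N α μ f x * fracLap N α θ x = -(κ * ∫ y, f y * θ y ∂μ) := by
    calc _ = ∫ x, ∫ y, rieszKernel N α (x - y) * f y * fracLap N α θ x ∂μ := by
          simp_rw [integral_mul_const]; rfl
      _ = ∫ y, (∫ x, rieszKernel N α (x - y) * f y * fracLap N α θ x) ∂μ :=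
          integral_integral_swap hF
      _ = ∫ y, -κ * (f y * θ y) ∂μ := by
          congr 1
          ext y
          rw [mul_left_comm, ← hκ θ hθ hc y, ← integral_const_mul]
          congr 1
          ext x
          rw [rieszKernel_sub_comm]; ring
      _ = _ := by rw [integral_const_mul, neg_mul]
  simp_rw [sub_mul, one_mul]
  rw [integral_sub hg hpg, hswap, integral_fracLap_eq_zero hN hα1 hα2 hθ hc]
  ring

lemma integrable_exp_neg_mul_sq_norm {b : ℝ} (hb : 0 < b) :
    Integrable fun w : Eucl N => Real.exp (-b * ‖w‖ ^ 2) := by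
  have h := GaussianFourier.integrable_cexp_neg_mul_sq_norm_add (b := (b : ℂ)) (by simpa) 0
    (0 : Eucl N)
  refine h.re.congr (Eventually.of_forall fun w => ?_)
  simp only [zero_mul, add_zero]
  rw [← Complex.ofReal_pow, ← Complex.ofReal_neg, ← Complex.ofReal_mul, ← Complex.ofReal_exp]
  rfl

lemma exp_mul_exp_eq (b : ℝ) (x x' w : Eucl N) :
    Real.exp (-b * ‖x - w‖ ^ 2) * Real.exp (-b * ‖x' - w‖ ^ 2)
      = Real.exp (-(b / 2) * ‖x - x'‖ ^ 2) *
        Real.exp (-(2 * b) * ‖w - (2⁻¹ : ℝ) • (x + x')‖ ^ 2) := by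
  rw [← Real.exp_add, ← Real.exp_add]
  congr 1
  have h := parallelogram_law_with_norm ℝ (x - w) (x' - w)
  rw [show x - w + (x' - w) = (-2 : ℝ) • (w - (2⁻¹ : ℝ) • (x + x')) by
    module, norm_smul, sub_sub_sub_cancel_right, mul_pow,
    show ‖(-2 : ℝ)‖ ^ 2 = 4 by norm_num] at h
  linear_combination (b / 2) * h

lemma exists_gaussKernel_sub_eq {t : ℝ} (ht : 0 < t) : ∃ b c : ℝ, 0 < b ∧ 0 ≤ c ∧
    ∀ x x' : Eucl N,
      Integrable (fun w => Real.exp (-b * ‖x - w‖ ^ 2) * Real.exp (-b * ‖x' - w‖ ^ 2)) ∧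
      gaussKernel N t (x - x')
        = c * ∫ w, Real.exp (-b * ‖x - w‖ ^ 2) * Real.exp (-b * ‖x' - w‖ ^ 2) := by
  set b := 2 * π ^ 2 / t
  have hb : 0 < b := by positivity
  have hi := integrable_exp_neg_mul_sq_norm (N := N) (b := 2 * b) (by positivity)
  set G := ∫ w : Eucl N, Real.exp (-(2 * b) * ‖w‖ ^ 2) with hG
  have hGpos : 0 < G := integral_exp_pos hi
  refine ⟨b, (π / t) ^ ((N : ℝ) / 2) / G, hb, by positivity, fun x x' => ?_⟩
  simp_rw [exp_mul_exp_eq]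
  refine ⟨(hi.comp_sub_right ((2⁻¹ : ℝ) • (x + x'))).const_mul _, ?_⟩
  rw [integral_const_mul, integral_sub_right_eq_self (fun w : Eucl N =>
    Real.exp (-(2 * b) * ‖w‖ ^ 2)) ((2⁻¹ : ℝ) • (x + x')), ← hG, gaussKernel]
  field_simp
  congr 1
  simp only [b]
  field_simp

lemma integral_gaussKernel_form_nonneg [IsFiniteMeasure μ] {F : Eucl N → ℝ} (hF : Measurable F)
    {M : ℝ} (hM : ∀ x, |F x| ≤ M) {t : ℝ} (ht : 0 < t) :
    0 ≤ ∫ p, gaussKernel N t (p.1 - p.2) * (F p.1 * F p.2) ∂(μ.prod μ) := by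
  obtain ⟨b, c, hb, hc, hbc⟩ := exists_gaussKernel_sub_eq (N := N) ht
  set E : Eucl N → Eucl N → ℝ := fun x w => Real.exp (-b * ‖x - w‖ ^ 2) with hE
  have hi : Integrable (Function.uncurry fun (p : Eucl N × Eucl N) (w : Eucl N) =>
      E p.1 w * E p.2 w * (F p.1 * F p.2)) ((μ.prod μ).prod volume) := by
    have hm : AEStronglyMeasurable (Function.uncurry fun (p : Eucl N × Eucl N) (w : Eucl N) =>
        E p.1 w * E p.2 w * (F p.1 * F p.2)) ((μ.prod μ).prod volume) := by
      refine Measurable.aestronglyMeasurable ?_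
      simp only [Function.uncurry_def, hE]
      fun_prop
    rw [integrable_prod_iff hm]
    refine ⟨Eventually.of_forall fun p => (hbc p.1 p.2).1.mul_const (F p.1 * F p.2), ?_⟩
    refine Integrable.of_bound hm.norm.integral_prod_right'
      ((∫ w : Eucl N, Real.exp (-b * ‖w‖ ^ 2)) * (M * M)) (Eventually.of_forall fun p => ?_)
    simp only [Function.uncurry_apply_pair]
    rw [Real.norm_of_nonneg (integral_nonneg fun _ => norm_nonneg _)]
    have hei := integrable_exp_neg_mul_sq_norm (N := N) hb
    have hei' : Integrable (fun w => E p.1 w * (M * M)) := (hei.comp_sub_left p.1).mul_const _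
    have hval : (∫ w : Eucl N, Real.exp (-b * ‖w‖ ^ 2)) * (M * M) = ∫ w, E p.1 w * (M * M) := by
      rw [← integral_sub_left_eq_self _ volume p.1, integral_mul_const]
    rw [hval]
    refine integral_mono_of_nonneg (Eventually.of_forall fun _ => norm_nonneg _) hei'
      (Eventually.of_forall fun w => ?_)
    have h1 : 0 ≤ E p.1 w := (Real.exp_pos _).le
    have h2 : 0 ≤ E p.2 w := (Real.exp_pos _).le
    have h3 : E p.2 w ≤ 1 := Real.exp_le_one_iff.2 (by
      have := mul_nonneg hb.le (sq_nonneg ‖p.2 - w‖); linarith)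
    simp only [norm_mul, Real.norm_eq_abs, abs_of_nonneg h1, abs_of_nonneg h2]
    exact mul_le_mul (mul_le_of_le_one_right h1 h3)
      (mul_le_mul (hM _) (hM _) (abs_nonneg _) ((abs_nonneg _).trans (hM 0))) (by positivity) h1
  calc (0 : ℝ) ≤ c * ∫ w, (∫ x, E x w * F x ∂μ) * (∫ x, E x w * F x ∂μ) :=
        mul_nonneg hc (integral_nonneg fun w => mul_self_nonneg _)
    _ = c * ∫ w, (∫ p, E p.1 w * E p.2 w * (F p.1 * F p.2) ∂(μ.prod μ)) := by
        congr 2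
        ext w
        rw [← integral_prod_mul]
        congr 1
        ext p
        ring
    _ = c * ∫ p, (∫ w, E p.1 w * E p.2 w * (F p.1 * F p.2)) ∂(μ.prod μ) := by
        rw [integral_integral_swap hi]
    _ = _ := by
        rw [← integral_const_mul]
        congr 1
        ext p
        rw [integral_mul_const, (hbc p.1 p.2).2, mul_assoc]

/-- The Riesz kernel is positive definite. -/
lemma integral_rieszKernel_form_nonneg (hN : 3 ≤ N) (hα2 : α < 2) [IsFiniteMeasure μ]
    [NullSingletonClass μ] {F : Eucl N → ℝ} (hF : Measurable F) {M : ℝ} (hM : ∀ x, |F x| ≤ M)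
    (hi : Integrable (fun p : Eucl N × Eucl N => rieszKernel N α (p.1 - p.2)) (μ.prod μ)) :
    0 ≤ ∫ p, rieszKernel N α (p.1 - p.2) * (F p.1 * F p.2) ∂(μ.prod μ) := by
  obtain ⟨C, hC, hCx⟩ := integral_gaussKernel (N := N) (α := α) hN hα2
  have hFm : Measurable fun p : Eucl N × Eucl N => F p.1 * F p.2 := by fun_prop
  have hΦF : Integrable (fun p : Eucl N × Eucl N => rieszKernel N α (p.1 - p.2) * (F p.1 * F p.2))
      (μ.prod μ) :=
    hi.mul_bdd (c := M * M) hFm.aestronglyMeasurable (Eventually.of_forall fun p => by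
      rw [norm_mul]
      exact mul_le_mul (hM _) (hM _) (abs_nonneg _) ((abs_nonneg _).trans (hM 0)))
  have hdiag : ∀ᵐ p ∂(μ.prod μ), p.1 ≠ p.2 := by
    have hd : MeasurableSet {q : Eucl N × Eucl N | q.1 ≠ q.2} :=
      (measurableSet_eq_fun measurable_fst measurable_snd).compl
    rw [Measure.ae_prod_iff_ae_ae hd]
    refine Eventually.of_forall fun x => ?_
    simp [ae_iff]
  have hsw : Integrable (Function.uncurry fun (p : Eucl N × Eucl N) (t : ℝ) =>
      t ^ (α / 2 - 1) * gaussKernel N t (p.1 - p.2) * (F p.1 * F p.2))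
      ((μ.prod μ).prod (volume.restrict (Set.Ioi 0))) := by
    have hm : AEStronglyMeasurable (Function.uncurry fun (p : Eucl N × Eucl N) (t : ℝ) =>
        t ^ (α / 2 - 1) * gaussKernel N t (p.1 - p.2) * (F p.1 * F p.2))
        ((μ.prod μ).prod (volume.restrict (Set.Ioi 0))) := by
      refine Measurable.aestronglyMeasurable (Measurable.mul (Measurable.mul (by fun_prop) ?_)
        (hFm.comp measurable_fst))
      exact measurable_gaussKernel.comp (measurable_snd.prodMk (by fun_prop))
    rw [integrable_prod_iff hm]
    constructor
    · filter_upwards [hdiag] with p hp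
      exact (hCx _ (sub_ne_zero.2 hp)).1.mul_const (F p.1 * F p.2)
    · refine (hΦF.norm.const_mul C).congr ?_
      filter_upwards [hdiag] with p hp
      have h := (hCx _ (sub_ne_zero.2 hp)).2
      rw [norm_mul, ← mul_assoc, Real.norm_of_nonneg (rieszKernel_nonneg _), ← h,
        ← integral_mul_const]
      refine setIntegral_congr_fun measurableSet_Ioi fun t ht => ?_
      have h1 := gaussKernel_nonneg ht (p.1 - p.2)
      have h2 : 0 ≤ t ^ (α / 2 - 1) := Real.rpow_nonneg (le_of_lt ht) _
      simp only [Function.uncurry_apply_pair]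
      rw [norm_mul _ (F p.1 * F p.2), Real.norm_of_nonneg (mul_nonneg h2 h1)]
  have hL : C * ∫ p, rieszKernel N α (p.1 - p.2) * (F p.1 * F p.2) ∂(μ.prod μ)
      = ∫ t in Set.Ioi 0, t ^ (α / 2 - 1) *
          ∫ p, gaussKernel N t (p.1 - p.2) * (F p.1 * F p.2) ∂(μ.prod μ) := by
    rw [← integral_const_mul]
    calc _ = ∫ p, (∫ t in Set.Ioi 0,
          t ^ (α / 2 - 1) * gaussKernel N t (p.1 - p.2) * (F p.1 * F p.2)) ∂(μ.prod μ) := by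
          refine integral_congr_ae ?_
          filter_upwards [hdiag] with p hp
          rw [integral_mul_const, (hCx _ (sub_ne_zero.2 hp)).2, mul_assoc]
      _ = _ := by
          rw [integral_integral_swap hsw]
          simp_rw [mul_assoc, integral_const_mul]
  refine (mul_nonneg_iff_of_pos_left hC).1 (hL ▸ setIntegral_nonneg measurableSet_Ioi
    fun t ht => mul_nonneg (Real.rpow_nonneg (le_of_lt ht) _)
      (integral_gaussKernel_form_nonneg hF hM ht))

end Energy

section RieszForm

variable {N : ℕ} {α : ℝ} {μ : Measure (Eucl N)}

/-- The mutual Riesz energy of two densities with respect to `μ`. -/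
def rieszForm (N : ℕ) (α : ℝ) (μ : Measure (Eucl N)) (f g : Eucl N → ℝ) : ℝ :=
  ∫ p, rieszKernel N α (p.1 - p.2) * (f p.1 * g p.2) ∂(μ.prod μ)

/-- Bounded measurable functions. -/
def IsBddMeas (f : Eucl N → ℝ) : Prop := Measurable f ∧ ∃ M, ∀ x, |f x| ≤ M

lemma IsBddMeas.const_mul {f : Eucl N → ℝ} (hf : IsBddMeas f) (a : ℝ) :
    IsBddMeas (fun x => a * f x) := by
  obtain ⟨hm, M, hM⟩ := hf
  exact ⟨hm.const_mul a, |a| * M, fun x => by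
    rw [abs_mul]; exact mul_le_mul_of_nonneg_left (hM x) (abs_nonneg a)⟩

lemma IsBddMeas.add {f g : Eucl N → ℝ} (hf : IsBddMeas f) (hg : IsBddMeas g) :
    IsBddMeas (fun x => f x + g x) := by
  obtain ⟨hm, M, hM⟩ := hf
  obtain ⟨hm', M', hM'⟩ := hg
  exact ⟨hm.add hm', M + M', fun x => (abs_add_le _ _).trans (add_le_add (hM x) (hM' x))⟩

lemma IsBddMeas.mul {f g : Eucl N → ℝ} (hf : IsBddMeas f) (hg : IsBddMeas g) :
    IsBddMeas (fun x => f x * g x) := by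
  obtain ⟨hm, M, hM⟩ := hf
  obtain ⟨hm', M', hM'⟩ := hg
  refine ⟨hm.mul hm', M * M', fun x => ?_⟩
  rw [abs_mul]
  exact mul_le_mul (hM x) (hM' x) (abs_nonneg _) ((abs_nonneg _).trans (hM x))

lemma isBddMeas_const (a : ℝ) : IsBddMeas (fun _ : Eucl N => a) :=
  ⟨measurable_const, |a|, fun _ => le_rfl⟩

lemma IsBddMeas.integrable [IsFiniteMeasure μ] {f : Eucl N → ℝ} (hf : IsBddMeas f) :
    Integrable f μ := by
  obtain ⟨hm, M, hM⟩ := hf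
  exact Integrable.of_bound hm.aestronglyMeasurable M (Eventually.of_forall hM)

lemma IsAdmissible.isBddMeas_rieszPot (h : IsAdmissible N α μ) (hN : 3 ≤ N) (hα1 : 0 < α)
    (hα2 : α < 2) {Λ : ℝ} (hΛ : ∀ x, ∫ y, rieszKernel N α (x - y) ∂μ ≤ Λ)
    {f : Eucl N → ℝ} (hf : IsBddMeas f) : IsBddMeas (rieszPot N α μ f) := by
  obtain ⟨hm, M, hM⟩ := hf
  exact ⟨(h.continuous_rieszPot hN hα1 hα2 hm hM).measurable, M * Λ, fun x =>
    (h.abs_rieszPot_le hN hα1 hα2 hM x).trans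
      (mul_le_mul_of_nonneg_left (hΛ x) ((abs_nonneg _).trans (hM 0)))⟩

lemma IsAdmissible.rieszPot_add_mul (h : IsAdmissible N α μ) (hN : 3 ≤ N) (hα1 : 0 < α)
    (hα2 : α < 2) {f g : Eucl N → ℝ} (hf : IsBddMeas f) (hg : IsBddMeas g) (a b : ℝ) (x : Eucl N) :
    rieszPot N α μ (fun y => a * f y + b * g y) x
      = a * rieszPot N α μ f x + b * rieszPot N α μ g x := by
  obtain ⟨hf, M, hM⟩ := hf
  obtain ⟨hg, M', hM'⟩ := hg
  unfold rieszPot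
  rw [← integral_const_mul, ← integral_const_mul, ← integral_add
    ((h.integrable_mul hN hα1 hα2 hf hM x).const_mul a)
    ((h.integrable_mul hN hα1 hα2 hg hM' x).const_mul b)]
  congr 1
  ext y
  ring

variable [IsFiniteMeasure μ]

lemma IsAdmissible.integrable_prod (h : IsAdmissible N α μ) (hN : 3 ≤ N) (hα1 : 0 < α)
    (hα2 : α < 2) {Λ : ℝ} (hΛ : ∀ x, ∫ y, rieszKernel N α (x - y) ∂μ ≤ Λ) :
    Integrable (fun p : Eucl N × Eucl N => rieszKernel N α (p.1 - p.2)) (μ.prod μ) := by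
  have hm : AEStronglyMeasurable (fun p : Eucl N × Eucl N => rieszKernel N α (p.1 - p.2))
      (μ.prod μ) := (measurable_rieszKernel.comp (by fun_prop)).aestronglyMeasurable
  rw [integrable_prod_iff hm]
  refine ⟨Eventually.of_forall fun x => h.integrable hN hα1 hα2 x,
    Integrable.of_bound hm.norm.integral_prod_right' Λ (Eventually.of_forall fun x => ?_)⟩
  rw [Real.norm_of_nonneg (integral_nonneg fun _ => norm_nonneg _)]
  simp_rw [Real.norm_of_nonneg (rieszKernel_nonneg _)]
  exact hΛ x

lemma IsAdmissible.integrable_form (h : IsAdmissible N α μ) (hN : 3 ≤ N) (hα1 : 0 < α)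
    (hα2 : α < 2) {Λ : ℝ} (hΛ : ∀ x, ∫ y, rieszKernel N α (x - y) ∂μ ≤ Λ)
    {f g : Eucl N → ℝ} (hf : IsBddMeas f) (hg : IsBddMeas g) :
    Integrable (fun p : Eucl N × Eucl N => rieszKernel N α (p.1 - p.2) * (f p.1 * g p.2))
      (μ.prod μ) := by
  obtain ⟨hf, M, hM⟩ := hf
  obtain ⟨hg, M', hM'⟩ := hg
  refine (h.integrable_prod hN hα1 hα2 hΛ).mul_bdd (c := M * M')
    ((hf.comp measurable_fst).mul (hg.comp measurable_snd)).aestronglyMeasurable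
    (Eventually.of_forall fun p => ?_)
  rw [norm_mul]
  exact mul_le_mul (hM _) (hM' _) (abs_nonneg _) ((abs_nonneg _).trans (hM 0))

lemma IsAdmissible.rieszForm_eq (h : IsAdmissible N α μ) (hN : 3 ≤ N) (hα1 : 0 < α)
    (hα2 : α < 2) {Λ : ℝ} (hΛ : ∀ x, ∫ y, rieszKernel N α (x - y) ∂μ ≤ Λ)
    {f g : Eucl N → ℝ} (hf : IsBddMeas f) (hg : IsBddMeas g) :
    rieszForm N α μ f g = ∫ x, f x * rieszPot N α μ g x ∂μ := by
  rw [rieszForm, integral_prod _ (h.integrable_form hN hα1 hα2 hΛ hf hg)]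
  congr 1
  ext x
  rw [rieszPot, ← integral_const_mul]
  congr 1
  ext y
  ring

lemma rieszForm_comm (f g : Eucl N → ℝ) : rieszForm N α μ f g = rieszForm N α μ g f := by
  unfold rieszForm
  rw [← integral_prod_swap]
  congr 1
  ext p
  simp only [Prod.fst_swap, Prod.snd_swap]
  rw [rieszKernel_sub_comm, mul_comm (f _)]

lemma IsAdmissible.rieszForm_add_mul_self (h : IsAdmissible N α μ) (hN : 3 ≤ N) (hα1 : 0 < α)
    (hα2 : α < 2) {Λ : ℝ} (hΛ : ∀ x, ∫ y, rieszKernel N α (x - y) ∂μ ≤ Λ)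
    {f g : Eucl N → ℝ} (hf : IsBddMeas f) (hg : IsBddMeas g) (a b : ℝ) :
    rieszForm N α μ (fun x => a * f x + b * g x) (fun x => a * f x + b * g x)
      = a ^ 2 * rieszForm N α μ f f + 2 * a * b * rieszForm N α μ g f
        + b ^ 2 * rieszForm N α μ g g := by
  have i1 := (h.integrable_form hN hα1 hα2 hΛ hf hf).const_mul (a ^ 2)
  have i2 := (h.integrable_form hN hα1 hα2 hΛ hf hg).const_mul (a * b)
  have i3 := (h.integrable_form hN hα1 hα2 hΛ hg hf).const_mul (a * b)
  have i4 := (h.integrable_form hN hα1 hα2 hΛ hg hg).const_mul (b ^ 2)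
  have e : rieszForm N α μ (fun x => a * f x + b * g x) (fun x => a * f x + b * g x)
      = a ^ 2 * rieszForm N α μ f f + a * b * rieszForm N α μ f g + a * b * rieszForm N α μ g f
        + b ^ 2 * rieszForm N α μ g g := by
    unfold rieszForm
    rw [← integral_const_mul, ← integral_const_mul, ← integral_const_mul, ← integral_const_mul,
      ← integral_add i1 i2, ← integral_add (by exact i1.add i2) i3,
      ← integral_add (by exact (i1.add i2).add i3) i4]
    congr 1
    ext p
    ring
  rw [e, rieszForm_comm f g]
  ring

lemma IsAdmissible.rieszForm_self_le (h : IsAdmissible N α μ) (hN : 3 ≤ N) (hα1 : 0 < α)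
    (hα2 : α < 2) {Λ : ℝ} (hΛ : ∀ x, ∫ y, rieszKernel N α (x - y) ∂μ ≤ Λ)
    {f : Eucl N → ℝ} (hf : IsBddMeas f) :
    rieszForm N α μ f f ≤ Λ * ∫ x, f x * f x ∂μ := by
  have h1 := isBddMeas_const (N := N) 1
  have hff := hf.mul hf
  have i1 := h.integrable_form hN hα1 hα2 hΛ hff h1
  have i2 := h.integrable_form hN hα1 hα2 hΛ h1 hff
  have e1 : rieszForm N α μ f f ≤ 2⁻¹ * (rieszForm N α μ (fun x => f x * f x) (fun _ => 1)
      + rieszForm N α μ (fun _ => 1) (fun x => f x * f x)) := by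
    unfold rieszForm
    rw [← integral_add i1 i2, ← integral_const_mul]
    refine integral_mono (h.integrable_form hN hα1 hα2 hΛ hf hf) ((i1.add i2).const_mul _)
      fun p => ?_
    have := mul_nonneg (rieszKernel_nonneg (α := α) (p.1 - p.2)) (sq_nonneg (f p.1 - f p.2))
    simp only
    nlinarith
  rw [rieszForm_comm (fun _ => 1), h.rieszForm_eq hN hα1 hα2 hΛ hff h1] at e1
  have e2 : ∫ x, f x * f x * rieszPot N α μ (fun _ => 1) x ∂μ ≤ ∫ x, Λ * (f x * f x) ∂μ := by
    refine integral_mono (hff.mul (h.isBddMeas_rieszPot hN hα1 hα2 hΛ h1)).integrable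
      (hff.const_mul Λ).integrable fun x => ?_
    have : rieszPot N α μ (fun _ => 1) x ≤ Λ := by simpa [rieszPot] using hΛ x
    simp only
    rw [mul_comm Λ]
    exact mul_le_mul_of_nonneg_left this (mul_self_nonneg _)
  rw [integral_const_mul] at e2
  linarith

lemma IsAdmissible.integral_rieszPot_sq_le [NullSingletonClass μ] (h : IsAdmissible N α μ)
    (hN : 3 ≤ N) (hα1 : 0 < α)
    (hα2 : α < 2) {Λ : ℝ} (hΛ : ∀ x, ∫ y, rieszKernel N α (x - y) ∂μ ≤ Λ) (hΛ0 : 0 < Λ)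
    {f : Eucl N → ℝ} (hf : IsBddMeas f) :
    ∫ x, rieszPot N α μ f x * rieszPot N α μ f x ∂μ ≤ Λ * rieszForm N α μ f f := by
  have hg := h.isBddMeas_rieszPot hN hα1 hα2 hΛ hf
  obtain ⟨hm, M, hM⟩ := (hf.const_mul 1).add (hg.const_mul (-Λ⁻¹))
  have h1 : 0 ≤ rieszForm N α μ (fun x => 1 * f x + -Λ⁻¹ * rieszPot N α μ f x)
      (fun x => 1 * f x + -Λ⁻¹ * rieszPot N α μ f x) :=
    integral_rieszKernel_form_nonneg hN hα2 hm hM (h.integrable_prod hN hα1 hα2 hΛ)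
  rw [h.rieszForm_add_mul_self hN hα1 hα2 hΛ hf hg, h.rieszForm_eq hN hα1 hα2 hΛ hg hf] at h1
  have h2 := h.rieszForm_self_le hN hα1 hα2 hΛ hg
  have h3 : Λ⁻¹ ^ 2 * rieszForm N α μ (rieszPot N α μ f) (rieszPot N α μ f)
      ≤ Λ⁻¹ * ∫ x, rieszPot N α μ f x * rieszPot N α μ f x ∂μ := by
    calc _ ≤ Λ⁻¹ ^ 2 * (Λ * ∫ x, rieszPot N α μ f x * rieszPot N α μ f x ∂μ) :=
          mul_le_mul_of_nonneg_left h2 (by positivity)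
      _ = _ := by field_simp
  have h4 : Λ⁻¹ * ∫ x, rieszPot N α μ f x * rieszPot N α μ f x ∂μ ≤ rieszForm N α μ f f := by
    have : (-Λ⁻¹) ^ 2 = Λ⁻¹ ^ 2 := neg_sq _
    rw [this] at h1
    linarith
  rwa [inv_mul_le_iff₀ hΛ0] at h4

lemma IsAdmissible.rieszForm_relaxation_le (h : IsAdmissible N α μ)
    (hN : 3 ≤ N) (hα1 : 0 < α)
    (hα2 : α < 2) {Λ : ℝ} (hΛ : ∀ x, ∫ y, rieszKernel N α (x - y) ∂μ ≤ Λ)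
    {d e : Eucl N → ℝ} (hd : IsBddMeas d) (he : IsBddMeas e) {L : ℝ}
    (hde : ∀ x, e x * e x ≤ -L * (e x * rieszPot N α μ d x)) {τ : ℝ} (hτ0 : 0 < τ)
    (hL : 0 < L) (hτ : τ * (Λ * L) ≤ 1 - τ) (hτ1 : τ < 1) :
    rieszForm N α μ (fun x => (1 - τ) * d x + τ * e x) (fun x => (1 - τ) * d x + τ * e x)
      ≤ (1 - τ) ^ 2 * rieszForm N α μ d d := by
  rw [h.rieszForm_add_mul_self hN hα1 hα2 hΛ hd he, h.rieszForm_eq hN hα1 hα2 hΛ he hd]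
  have h1 := h.rieszForm_self_le hN hα1 hα2 hΛ he
  have hVd := h.isBddMeas_rieszPot hN hα1 hα2 hΛ hd
  have h2 : ∫ x, e x * e x ∂μ ≤ -L * ∫ x, e x * rieszPot N α μ d x ∂μ := by
    rw [← integral_const_mul]
    exact integral_mono (he.mul he).integrable ((he.mul hVd).const_mul _).integrable hde
  have h0 : 0 ≤ ∫ x, e x * e x ∂μ := integral_nonneg fun x => mul_self_nonneg _
  set I := ∫ x, e x * e x ∂μ
  set J := ∫ x, e x * rieszPot N α μ d x ∂μ
  have hJ : J ≤ 0 := by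
    have : 0 ≤ -L * J := h0.trans h2
    nlinarith
  have h3 : τ * rieszForm N α μ e e ≤ -(1 - τ) * J := by
    by_cases hΛ0 : 0 ≤ Λ
    · calc τ * rieszForm N α μ e e ≤ τ * (Λ * (-L * J)) :=
            mul_le_mul_of_nonneg_left (h1.trans (mul_le_mul_of_nonneg_left h2 hΛ0)) hτ0.le
        _ = (τ * (Λ * L)) * (-J) := by ring
        _ ≤ (1 - τ) * (-J) := mul_le_mul_of_nonneg_right hτ (by linarith)
        _ = _ := by ring
    · have : rieszForm N α μ e e ≤ 0 := h1.trans (mul_nonpos_of_nonpos_of_nonneg (by linarith) h0)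
      nlinarith
  have h4 : (1 - τ) * J ≤ 0 := mul_nonpos_of_nonneg_of_nonpos (by linarith) hJ
  nlinarith

end RieszForm

section LipschitzProblem

variable {N : ℕ} {α : ℝ} {μ : Measure (Eucl N)}

lemma IsAdmissible.tendsto_rieszPot (h : IsAdmissible N α μ) (hN : 3 ≤ N) (hα1 : 0 < α)
    (hα2 : α < 2) {f : ℕ → Eucl N → ℝ} {g : Eucl N → ℝ} (hf : ∀ k, Measurable (f k)) {M : ℝ}
    (hM : ∀ k x, |f k x| ≤ M) (hfg : ∀ x, Tendsto (fun k => f k x) atTop (𝓝 (g x))) (x : Eucl N) :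
    Tendsto (fun k => rieszPot N α μ (f k) x) atTop (𝓝 (rieszPot N α μ g x)) := by
  refine tendsto_integral_of_dominated_convergence (fun y => rieszKernel N α (x - y) * M)
    (fun k => (h.integrable_mul hN hα1 hα2 (hf k) (hM k) x).aestronglyMeasurable)
    ((h.integrable hN hα1 hα2 x).mul_const M)
    (fun k => Eventually.of_forall fun y => ?_)
    (Eventually.of_forall fun y => (hfg y).const_mul _)
  rw [norm_mul, Real.norm_of_nonneg (rieszKernel_nonneg _)]
  exact mul_le_mul_of_nonneg_left (hM k y) (rieszKernel_nonneg _)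

/-- Relaxed Picard iterates for the density `y = ψ (1 - rieszPot μ y)`. -/
def relaxIter (N : ℕ) (α : ℝ) (μ : Measure (Eucl N)) (ψ : ℝ → ℝ) (τ : ℝ) : ℕ → Eucl N → ℝ
  | 0 => fun _ => 0
  | k + 1 => fun x => (1 - τ) * relaxIter N α μ ψ τ k x
      + τ * ψ (1 - rieszPot N α μ (relaxIter N α μ ψ τ k) x)

lemma IsAdmissible.relaxIter_mem (h : IsAdmissible N α μ) (hN : 3 ≤ N) (hα1 : 0 < α)
    (hα2 : α < 2) {ψ : ℝ → ℝ} (hψ : Continuous ψ) (h0 : ∀ t, 0 ≤ ψ t) {M : ℝ}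
    (hM : ∀ t, ψ t ≤ M) {τ : ℝ} (hτ0 : 0 ≤ τ) (hτ1 : τ ≤ 1) (k : ℕ) :
    Measurable (relaxIter N α μ ψ τ k) ∧
      ∀ x, 0 ≤ relaxIter N α μ ψ τ k x ∧ relaxIter N α μ ψ τ k x ≤ M := by
  induction k with
  | zero => exact ⟨measurable_const, fun x => ⟨le_rfl, (h0 0).trans (hM 0)⟩⟩
  | succ k ih =>
    obtain ⟨hm, hb⟩ := ih
    have hc := h.continuous_rieszPot hN hα1 hα2 hm (M := M)
      fun x => by rw [abs_of_nonneg (hb x).1]; exact (hb x).2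
    refine ⟨(hm.const_mul _).add ((hψ.comp (continuous_const.sub hc)).measurable.const_mul _),
      fun x => ⟨?_, ?_⟩⟩
    · exact add_nonneg (mul_nonneg (by linarith) (hb x).1) (mul_nonneg hτ0 (h0 _))
    · have h1 := mul_le_mul_of_nonneg_left (hb x).2 (by linarith : 0 ≤ 1 - τ)
      have h2 := mul_le_mul_of_nonneg_left
        (hM (1 - rieszPot N α μ (relaxIter N α μ ψ τ k) x)) hτ0
      change (1 - τ) * _ + τ * _ ≤ M
      linarith

lemma sub_mul_self_le_of_monotone_of_lipschitz {ψ : ℝ → ℝ} (hψ : Monotone ψ) {L : ℝ}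
    (hψL : ∀ a b, |ψ a - ψ b| ≤ L * |a - b|) (a b : ℝ) :
    (ψ a - ψ b) * (ψ a - ψ b) ≤ L * ((ψ a - ψ b) * (a - b)) := by
  have h1 : (ψ a - ψ b) * (a - b) = |ψ a - ψ b| * |a - b| := by
    rw [← abs_mul, abs_of_nonneg]
    rcases le_total a b with hab | hab
    · exact mul_nonneg_of_nonpos_of_nonpos (sub_nonpos.2 (hψ hab)) (sub_nonpos.2 hab)
    · exact mul_nonneg (sub_nonneg.2 (hψ hab)) (sub_nonneg.2 hab)
  rw [h1, ← abs_mul_abs_self (ψ a - ψ b)]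
  nlinarith [mul_le_mul_of_nonneg_left (hψL a b) (abs_nonneg (ψ a - ψ b))]

lemma IsAdmissible.exists_eq_one_sub_rieszPot_of_lipschitz [IsFiniteMeasure μ]
    [NullSingletonClass μ] (h : IsAdmissible N α μ) (hN : 3 ≤ N) (hα1 : 0 < α) (hα2 : α < 2)
    {Λ : ℝ} (hΛ : ∀ x, ∫ y, rieszKernel N α (x - y) ∂μ ≤ Λ) (hΛ0 : 0 < Λ) {ψ : ℝ → ℝ}
    (hψ : Monotone ψ) {L : ℝ} (hL : 0 < L) (hψL : ∀ a b, |ψ a - ψ b| ≤ L * |a - b|)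
    (h0 : ∀ t, 0 ≤ ψ t) {M : ℝ} (hM : ∀ t, ψ t ≤ M) :
    ∃ u : Eucl N → ℝ, Continuous u ∧ ∀ x, u x = 1 - rieszPot N α μ (fun y => ψ (u y)) x := by
  have hψc : Continuous ψ := by
    refine (LipschitzWith.of_dist_le_mul (K := ⟨L, hL.le⟩) fun a b => ?_).continuous
    rw [Real.dist_eq, Real.dist_eq]
    exact hψL a b
  have hM0 : 0 ≤ M := (h0 0).trans (hM 0)
  set τ : ℝ := 1 / (1 + Λ * L) with hτ
  have hΛL := mul_pos hΛ0 hL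
  have hτ0 : 0 < τ := by positivity
  have hτe : τ * (Λ * L) = 1 - τ := by rw [hτ]; field_simp; ring
  have hτ1 : τ < 1 := by nlinarith [mul_pos hτ0 hΛL]
  set y := relaxIter N α μ ψ τ with hy
  have hmem := h.relaxIter_mem hN hα1 hα2 hψc h0 hM hτ0.le hτ1.le
  have hyM : ∀ k x, |y k x| ≤ M := fun k x => by
    rw [abs_of_nonneg ((hmem k).2 x).1]; exact ((hmem k).2 x).2
  have hyb : ∀ k, IsBddMeas (y k) := fun k => ⟨(hmem k).1, M, hyM k⟩
  have hyc : ∀ k, Continuous (rieszPot N α μ (y k)) := fun k =>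
    h.continuous_rieszPot hN hα1 hα2 (hmem k).1 (hyM k)
  set v : ℕ → Eucl N → ℝ := fun k x => 1 - rieszPot N α μ (y k) x with hv
  have hvc : ∀ k, Continuous (v k) := fun k => continuous_const.sub (hyc k)
  have hψabs : ∀ t, |ψ t| ≤ M := fun t => by rw [abs_of_nonneg (h0 t)]; exact hM t
  have hψb : ∀ k, IsBddMeas (fun x => ψ (v k x)) := fun k =>
    ⟨(hψc.comp (hvc k)).measurable, M, fun x => hψabs _⟩
  have hstep : ∀ k x, y (k + 1) x = (1 - τ) * y k x + τ * ψ (v k x) := fun k x => rfl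
  set d : ℕ → Eucl N → ℝ := fun k x => 1 * y (k + 1) x + -1 * y k x with hd
  have hdb : ∀ k, IsBddMeas (d k) := fun k => ((hyb _).const_mul _).add ((hyb _).const_mul _)
  have hdM : ∀ k x, |d k x| ≤ M := fun k x => by
    have h1 := (hmem k).2 x
    have h2 := (hmem (k + 1)).2 x
    rw [abs_le]
    constructor <;> simp only [hd, hy] <;> linarith [h1.1, h1.2, h2.1, h2.2]
  have hVd : ∀ k x, rieszPot N α μ (d k) x = v k x - v (k + 1) x := fun k x => by
    rw [h.rieszPot_add_mul hN hα1 hα2 (hyb _) (hyb _)]; simp only [hv]; ring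
  have hVd' : ∀ k x, rieszPot N α μ (d k) x
      = τ * rieszPot N α μ (fun x => ψ (v k x)) x + -τ * rieszPot N α μ (y k) x := fun k x => by
    rw [← h.rieszPot_add_mul hN hα1 hα2 (hψb _) (hyb _)]
    congr 1
    ext z
    simp only [hd, hstep]
    ring
  set F : ℕ → ℝ := fun k => rieszForm N α μ (d k) (d k) with hF
  have hFstep : ∀ k, F (k + 1) ≤ (1 - τ) ^ 2 * F k := fun k => by
    have he : IsBddMeas fun x => ψ (v (k + 1) x) - ψ (v k x) := by
      have := (hψb (k + 1)).add ((hψb k).const_mul (-1))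
      simpa [sub_eq_add_neg] using this
    have := h.rieszForm_relaxation_le hN hα1 hα2 hΛ (hdb k) he (L := L) (fun x => by
      rw [hVd]
      have := sub_mul_self_le_of_monotone_of_lipschitz hψ hψL (v (k + 1) x) (v k x)
      linarith) hτ0 hL hτe.le hτ1
    convert this using 2 <;>
    · ext x
      simp only [hd, hstep]
      ring
  have hFle : ∀ k, F k ≤ ((1 - τ) ^ 2) ^ k * F 0 := fun k => by
    induction k with
    | zero => simp
    | succ k ih =>
      calc F (k + 1) ≤ (1 - τ) ^ 2 * F k := hFstep k
        _ ≤ (1 - τ) ^ 2 * (((1 - τ) ^ 2) ^ k * F 0) :=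
          mul_le_mul_of_nonneg_left ih (sq_nonneg _)
        _ = _ := by ring
  have hsq : Tendsto (fun k => ∫ x, rieszPot N α μ (d k) x * rieszPot N α μ (d k) x ∂μ)
      atTop (𝓝 0) := by
    refine squeeze_zero (g := fun k => Λ * (((1 - τ) ^ 2) ^ k * F 0))
      (fun k => integral_nonneg fun x => mul_self_nonneg _)
      (fun k => (h.integral_rieszPot_sq_le hN hα1 hα2 hΛ hΛ0 (hdb k)).trans
        (mul_le_mul_of_nonneg_left (hFle k) hΛ0.le)) ?_
    have := ((tendsto_pow_atTop_nhds_zero_of_lt_one (sq_nonneg (1 - τ))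
      (by nlinarith : (1 - τ) ^ 2 < 1)).mul_const (F 0)).const_mul Λ
    simpa using this
  obtain ⟨s, hs, p, hp⟩ := h.exists_subseq_tendsto hN hα1 hα2 (fun k => (hmem k).1) hyM
  set w : Eucl N → ℝ := fun x => 1 - p x with hw
  have hvw : ∀ x, Tendsto (fun k => v (s k) x) atTop (𝓝 (w x)) := fun x => (hp x).const_sub 1
  have hwm : Measurable w := measurable_of_tendsto_metrizable (fun k => (hvc (s k)).measurable)
    (tendsto_pi_nhds.2 hvw)
  have hVψ : ∀ x, Tendsto (fun k => rieszPot N α μ (fun z => ψ (v (s k) z)) x) atTop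
      (𝓝 (rieszPot N α μ (fun z => ψ (w z)) x)) :=
    h.tendsto_rieszPot hN hα1 hα2 (fun k => (hψb (s k)).1) (fun k x => hψabs _)
      fun x => (hψc.tendsto _).comp (hvw x)
  set H : Eucl N → ℝ := fun x => τ * rieszPot N α μ (fun z => ψ (w z)) x + -τ * p x with hH
  have hVdH : ∀ x, Tendsto (fun k => rieszPot N α μ (d (s k)) x) atTop (𝓝 (H x)) := fun x => by
    simp only [hVd', hH]
    exact ((hVψ x).const_mul _).add ((hp x).const_mul _)
  have hVdM : ∀ k x, |rieszPot N α μ (d k) x| ≤ M * Λ := fun k x =>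
    (h.abs_rieszPot_le hN hα1 hα2 (hdM k) x).trans (mul_le_mul_of_nonneg_left (hΛ x) hM0)
  have hVdc : ∀ k, Continuous (rieszPot N α μ (d k)) := fun k =>
    h.continuous_rieszPot hN hα1 hα2 (hdb k).1 (hdM k)
  have hHm : Measurable H := measurable_of_tendsto_metrizable
    (fun k => (hVdc (s k)).measurable) (tendsto_pi_nhds.2 hVdH)
  have hHM : ∀ x, |H x| ≤ M * Λ := fun x =>
    le_of_tendsto (hVdH x).abs (Eventually.of_forall fun k => hVdM (s k) x)
  have hH0 : ∫ x, H x * H x ∂μ = 0 := by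
    refine tendsto_nhds_unique ?_ (hsq.comp hs.tendsto_atTop)
    refine tendsto_integral_of_dominated_convergence (fun _ => (M * Λ) * (M * Λ))
      (fun k => ((hVdc (s k)).mul (hVdc (s k))).aestronglyMeasurable) (integrable_const _)
      (fun k => Eventually.of_forall fun x => ?_)
      (Eventually.of_forall fun x => (hVdH x).mul (hVdH x))
    rw [norm_mul]
    exact mul_le_mul (hVdM _ x) (hVdM _ x) (abs_nonneg _) (by positivity)
  have hHb : IsBddMeas H := ⟨hHm, _, hHM⟩
  rw [integral_eq_zero_iff_of_nonneg (fun x => mul_self_nonneg _) (hHb.mul hHb).integrable] at hH0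
  have hae : ∀ᵐ x ∂μ, 1 - rieszPot N α μ (fun z => ψ (w z)) x = w x := by
    filter_upwards [hH0] with x hx
    have hx' : H x = 0 := mul_self_eq_zero.1 hx
    have : τ * (rieszPot N α μ (fun z => ψ (w z)) x - p x) = 0 := by
      rw [← hx']; simp only [hH]; ring
    have := (mul_eq_zero.1 this).resolve_left hτ0.ne'
    simp only [hw]
    linarith
  refine ⟨fun x => 1 - rieszPot N α μ (fun z => ψ (w z)) x, continuous_const.sub
    (h.continuous_rieszPot hN hα1 hα2 (hψc.measurable.comp hwm) fun x => hψabs _), fun x => ?_⟩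
  refine congrArg (fun t => 1 - t) (integral_congr_ae ?_)
  filter_upwards [hae] with z hz
  simp only [hz]

end LipschitzProblem

section MaximumPrinciple

variable {N : ℕ} {α : ℝ}

/-- The average of `u` around `b` against the weight `η`. -/
def mollify (η u : Eucl N → ℝ) (b : Eucl N) : ℝ := ∫ w, u (b + w) * η w

lemma mollify_eq_integral_sub (η u : Eucl N → ℝ) (b : Eucl N) :
    mollify η u b = ∫ x, u x * η (x - b) := by
  rw [mollify, ← integral_sub_right_eq_self (fun w => u (b + w) * η w) b]
  simp

lemma integrable_mul_of_hasCompactSupport {η u : Eucl N → ℝ} (hη : Continuous η)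
    (hc : HasCompactSupport η) (hu : Continuous u) (b : Eucl N) :
    Integrable (fun w => u (b + w) * η w) :=
  ((hu.comp (continuous_const_add b)).mul hη).integrable_of_hasCompactSupport hc.mul_left

lemma continuous_mollify {η u : Eucl N → ℝ} (hη : Continuous η)
    (hc : HasCompactSupport η) (hu : Continuous u) {C : ℝ} (hC : ∀ x, |u x| ≤ C) :
    Continuous (mollify η u) := by
  refine continuous_of_dominated (bound := fun w => C * |η w|)
    (fun b => (integrable_mul_of_hasCompactSupport hη hc hu b).aestronglyMeasurable)
    (fun b => Eventually.of_forall fun w => ?_)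
    ((hη.integrable_of_hasCompactSupport hc).abs.const_mul C)
    (Eventually.of_forall fun w => by fun_prop)
  rw [norm_mul]
  exact mul_le_mul_of_nonneg_right (hC _) (abs_nonneg _)

lemma le_mollify {η u : Eucl N → ℝ} (hη : Continuous η) (hc : HasCompactSupport η)
    (hη0 : ∀ x, 0 ≤ η x) (hη1 : ∫ x, η x = 1) {ε : ℝ} (hs : ∀ x, ε ≤ ‖x‖ → η x = 0)
    (hu : Continuous u) {a : Eucl N} {c : ℝ} (h : ∀ x, ‖x - a‖ < ε → c ≤ u x) :
    c ≤ mollify η u a := by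
  have : c = ∫ x, c * η x := by rw [integral_const_mul, hη1, mul_one]
  rw [this]
  refine integral_mono ((hη.integrable_of_hasCompactSupport hc).const_mul c)
    (integrable_mul_of_hasCompactSupport hη hc hu a) fun w => ?_
  rcases lt_or_ge ‖w‖ ε with hw | hw
  · exact mul_le_mul_of_nonneg_right (h _ (by simpa using hw)) (hη0 w)
  · simp [hs w hw]

lemma mollify_le {η u : Eucl N → ℝ} (hη : Continuous η) (hc : HasCompactSupport η)
    (hη0 : ∀ x, 0 ≤ η x) (hη1 : ∫ x, η x = 1) {ε : ℝ} (hs : ∀ x, ε ≤ ‖x‖ → η x = 0)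
    (hu : Continuous u) {a : Eucl N} {c : ℝ} (h : ∀ x, ‖x - a‖ < ε → u x ≤ c) :
    mollify η u a ≤ c := by
  have h1 := le_mollify hη hc hη0 hη1 hs hu.neg (a := a) (c := -c)
    fun x hx => neg_le_neg (h x hx)
  have h2 : mollify η (-u) a = -mollify η u a := by
    simp [mollify, integral_neg]
  rw [h2] at h1
  linarith

lemma integral_mul_fracLap_translate (hN : 3 ≤ N) (hα1 : 0 < α) (hα2 : α < 2)
    {η u : Eucl N → ℝ} (hη : ContDiff ℝ (⊤ : ℕ∞) η) (hc : HasCompactSupport η)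
    (hu : Continuous u) {C : ℝ} (hC : ∀ x, |u x| ≤ C) (a : Eucl N) :
    Integrable (fun z => secondDiff (mollify η u) a z / ‖z‖ ^ ((N : ℝ) + α)) ∧
    ∫ x, u x * fracLap N α (fun x => η (x - a)) x
      = fracLapCoeff N α / 2 * ∫ z, secondDiff (mollify η u) a z / ‖z‖ ^ ((N : ℝ) + α) := by
  set θ : Eucl N → ℝ := fun x => η (x - a) with hθ
  have hθs : ContDiff ℝ (⊤ : ℕ∞) θ := hη.comp (contDiff_id.sub contDiff_const)
  have hθc : HasCompactSupport θ := hc.comp_homeomorph (Homeomorph.subRight a)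
  have hi := integrable_secondDiff_div hN hα1 hα2 hθs hθc
  have hi' : Integrable (fun p : Eucl N × Eucl N =>
      u p.1 * (secondDiff θ p.1 p.2 / ‖p.2‖ ^ ((N : ℝ) + α))) (volume.prod volume) :=
    hi.bdd_mul (c := C) (hu.comp continuous_fst).aestronglyMeasurable
      (Eventually.of_forall fun p => hC p.1)
  have key : ∀ z, ∫ x, u x * (secondDiff θ x z / ‖z‖ ^ ((N : ℝ) + α))
      = secondDiff (mollify η u) a z / ‖z‖ ^ ((N : ℝ) + α) := fun z => by
    have hintg : ∀ b, Integrable (fun x => u x * η (x - b)) := fun b =>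
      (hu.mul (hη.continuous.comp (continuous_id.sub continuous_const))).integrable_of_hasCompactSupport
        (HasCompactSupport.mul_left (hc.comp_homeomorph (Homeomorph.subRight b)))
    have e : ∀ x, u x * (secondDiff θ x z / ‖z‖ ^ ((N : ℝ) + α))
        = (u x * η (x - (a - z)) + u x * η (x - (a + z)) - 2 * (u x * η (x - a)))
          / ‖z‖ ^ ((N : ℝ) + α) := fun x => by
      have e1 : x - (a - z) = x + z - a := by abel
      have e2 : x - (a + z) = x - z - a := by abel
      simp only [secondDiff, hθ, e1, e2]
      ring
    simp only [e]
    rw [integral_div, integral_sub (by exact (hintg _).add (hintg _)) ((hintg a).const_mul 2),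
      integral_add (hintg _) (hintg _), integral_const_mul, ← mollify_eq_integral_sub,
      ← mollify_eq_integral_sub, ← mollify_eq_integral_sub, secondDiff]
    ring
  constructor
  · simpa only [key] using hi'.integral_prod_right
  · calc ∫ x, u x * fracLap N α θ x
        = ∫ x, fracLapCoeff N α / 2 * ∫ z, u x * (secondDiff θ x z / ‖z‖ ^ ((N : ℝ) + α)) := by
          congr 1
          ext x
          rw [fracLap_eq, integral_const_mul]
          ring
      _ = fracLapCoeff N α / 2 * ∫ z, ∫ x, u x * (secondDiff θ x z / ‖z‖ ^ ((N : ℝ) + α)) := by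
          rw [integral_const_mul, integral_integral_swap hi']
      _ = _ := by simp only [key]

/-- Maximum principle: a bounded continuous function which is nonnegative near infinity and
`α`-superharmonic where it is negative is nonnegative. -/
lemma nonneg_of_integral_mul_fracLap_nonpos (hN : 3 ≤ N) (hα1 : 0 < α) (hα2 : α < 2)
    {u : Eucl N → ℝ} (hu : Continuous u) {C : ℝ} (hC : ∀ x, |u x| ≤ C) {R : ℝ}
    (hR : ∀ x, R ≤ ‖x‖ → 0 ≤ u x)
    (h : ∀ θ : Eucl N → ℝ, ContDiff ℝ (⊤ : ℕ∞) θ → HasCompactSupport θ →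
      (∀ x, θ x ≠ 0 → u x < 0) → ∫ x, u x * fracLap N α θ x ≤ 0) (x : Eucl N) : 0 ≤ u x := by
  by_contra! hx
  have hxR : ‖x‖ < R := by
    by_contra! h1
    exact absurd (hR x h1) (not_le.2 hx)
  have hR0 : 0 < R := (norm_nonneg x).trans_lt hxR
  obtain ⟨x₁, -, hmin⟩ := (isCompact_closedBall (0 : Eucl N) R).exists_isMinOn
    ⟨x, by simpa using hxR.le⟩ hu.continuousOn
  set m := u x₁ with hm
  have hm0 : m < 0 := (hmin (by simpa using hxR.le : x ∈ Metric.closedBall 0 R)).trans_lt hx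
  have hx₁ : ‖x₁‖ < R := by
    by_contra! h1
    exact absurd (hR x₁ h1) (not_le.2 hm0)
  have huc := (isCompact_closedBall (0 : Eucl N) (R + 2)).uniformContinuousOn_of_continuous
    hu.continuousOn
  obtain ⟨δ', hδ'0, hδ'⟩ := Metric.uniformContinuousOn_iff.1 huc (-m / 8) (by linarith)
  set δ := min δ' 1 with hδ
  have hδ0 : 0 < δ := lt_min hδ'0 one_pos
  have hclose : ∀ a y : Eucl N, ‖a‖ ≤ R + 1 → ‖y - a‖ < δ → |u y - u a| < -m / 8 := by
    intro a y ha hy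
    rw [← Real.dist_eq]
    have h1 : ‖y - a‖ < 1 := hy.trans_le (min_le_right _ _)
    have h2 : ‖y‖ ≤ ‖y - a‖ + ‖a‖ := by simpa using norm_add_le (y - a) a
    refine hδ' y ?_ a ?_ ?_
    · rw [mem_closedBall_zero_iff]; linarith
    · rw [mem_closedBall_zero_iff]; linarith
    · rw [dist_eq_norm]; exact hy.trans_le (min_le_left _ _)
  let b : ContDiffBump (0 : Eucl N) := ⟨δ / 2, δ, by linarith, by linarith⟩
  set η : Eucl N → ℝ := b.normed volume with hη
  have hηs : ContDiff ℝ (⊤ : ℕ∞) η := b.contDiff_normed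
  have hηc : HasCompactSupport η := b.hasCompactSupport_normed
  have hη0 : ∀ x, 0 ≤ η x := b.nonneg_normed
  have hη1 : ∫ x, η x = 1 := b.integral_normed
  have hsupp : ∀ x, δ ≤ ‖x‖ → η x = 0 := fun x hx => by
    by_contra h1
    have h2 : x ∈ Function.support (b.normed volume) := h1
    rw [b.support_normed_eq] at h2
    have h3 : ‖x‖ < δ := by simpa using h2
    linarith
  set v := mollify η u with hv
  have hvc : Continuous v := continuous_mollify hηs.continuous hηc hu hC
  have hv0 : ∀ y, R + 1 ≤ ‖y‖ → 0 ≤ v y := fun y hy =>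
    le_mollify hηs.continuous hηc hη0 hη1 hsupp hu fun z hz => hR z (by
      have h1 : ‖z - y‖ < 1 := hz.trans_le (min_le_right _ _)
      have h2 : ‖y‖ ≤ ‖z - y‖ + ‖z‖ := by simpa [norm_sub_rev] using norm_add_le (y - z) z
      linarith)
  have hvx₁ : v x₁ ≤ 7 / 8 * m := mollify_le hηs.continuous hηc hη0 hη1 hsupp hu fun z hz => by
    have := (abs_lt.1 (hclose x₁ z (by linarith) hz)).2
    linarith
  obtain ⟨a, haR, hamin⟩ := (isCompact_closedBall (0 : Eucl N) (R + 1)).exists_isMinOn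
    ⟨x₁, by rw [mem_closedBall_zero_iff]; linarith⟩ hvc.continuousOn
  rw [mem_closedBall_zero_iff] at haR
  have hva : v a ≤ 7 / 8 * m := le_trans
    (hamin (by rw [mem_closedBall_zero_iff]; linarith : x₁ ∈ Metric.closedBall 0 (R + 1))) hvx₁
  have hglob : ∀ y, v a ≤ v y := fun y => by
    rcases le_total ‖y‖ (R + 1) with hy | hy
    · exact hamin (by rwa [mem_closedBall_zero_iff] : y ∈ Metric.closedBall 0 (R + 1))
    · linarith [hv0 y hy]
  have hua : u a < m / 2 := by
    by_contra! h1
    have : 5 / 8 * m ≤ v a := le_mollify hηs.continuous hηc hη0 hη1 hsupp hu fun z hz => by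
      have := (abs_lt.1 (hclose a z haR hz)).1
      linarith
    linarith
  obtain ⟨hintg, heq⟩ := integral_mul_fracLap_translate hN hα1 hα2 hηs hηc hu hC a
  have hle := h (fun x => η (x - a)) (hηs.comp (contDiff_id.sub contDiff_const))
    (hηc.comp_homeomorph (Homeomorph.subRight a)) fun z hz => by
      have hz' : ‖z - a‖ < δ := by
        by_contra! h1
        exact hz (hsupp _ h1)
      have := (abs_lt.1 (hclose a z haR hz')).2
      linarith
  rw [heq] at hle
  have hcoef := fracLapCoeff_pos (N := N) hα1 hα2
  have hG0 : ∀ z, 0 ≤ secondDiff v a z / ‖z‖ ^ ((N : ℝ) + α) := fun z => by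
    refine div_nonneg ?_ (by positivity)
    rw [secondDiff]
    linarith [hglob (a + z), hglob (a - z)]
  have hI0 : ∫ z, secondDiff v a z / ‖z‖ ^ ((N : ℝ) + α) = 0 := by
    refine le_antisymm ?_ (integral_nonneg hG0)
    by_contra! h1
    nlinarith [mul_pos hcoef h1]
  rw [integral_eq_zero_iff_of_nonneg hG0 hintg] at hI0
  have hdense : Dense {z | secondDiff v a z / ‖z‖ ^ ((N : ℝ) + α) = 0} :=
    Measure.dense_of_ae hI0
  have hne : {z : Eucl N | 2 * R + 2 < ‖z‖}.Nonempty := by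
    refine ⟨EuclideanSpace.single ⟨0, by omega⟩ (2 * R + 3), ?_⟩
    have h1 := le_abs_self (2 * R + 3)
    simp only [Set.mem_ofPred_eq, PiLp.norm_single, Real.norm_eq_abs]
    linarith
  obtain ⟨z, hz, hz0⟩ := hdense.exists_mem_open
    (isOpen_lt continuous_const continuous_norm) hne
  have hz' : 2 * R + 2 < ‖z‖ := hz0
  have hzp : 0 < ‖z‖ ^ ((N : ℝ) + α) := Real.rpow_pos_of_pos (by linarith) _
  have hz1 : secondDiff v a z = 0 := (div_eq_zero_iff.1 hz).resolve_right hzp.ne'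
  have h1 : ‖z‖ ≤ ‖a + z‖ + ‖a‖ := by simpa [add_comm] using norm_sub_le (a + z) a
  have h2 : ‖z‖ ≤ ‖a - z‖ + ‖a‖ := by
    have := norm_sub_le a (a - z)
    rw [sub_sub_cancel] at this
    linarith
  rw [secondDiff] at hz1
  linarith [hv0 (a + z) (by linarith), hv0 (a - z) (by linarith)]

end MaximumPrinciple

section Existence

open scoped NNReal

variable {N : ℕ} {α : ℝ} {μ : Measure (Eucl N)}

lemma IsAdmissible.exists_integral_rieszKernel_le [IsFiniteMeasure μ] (h : IsAdmissible N α μ)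
    (hN : 3 ≤ N) (hα1 : 0 < α) (hα2 : α < 2) {M : ℝ≥0} (hM : μ ≤ M • volume) :
    ∃ Λ : ℝ, 0 < Λ ∧ ∀ x, ∫ y, rieszKernel N α (x - y) ∂μ ≤ Λ := by
  have hN' : (3 : ℝ) ≤ N := by exact_mod_cast hN
  have hI0 : 0 ≤ ∫ y in Metric.ball (0 : Eucl N) 1, rieszKernel N α y :=
    integral_nonneg fun y => rieszKernel_nonneg _
  refine ⟨M * (∫ y in Metric.ball (0 : Eucl N) 1, rieszKernel N α y) + μ.real Set.univ + 1,
    by positivity, fun x => ?_⟩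
  have hi := h.integrable hN hα1 hα2 x
  rw [← integral_add_compl (measurableSet_ball : MeasurableSet (Metric.ball x 1)) hi]
  have h1 : ∫ y in Metric.ball x 1, rieszKernel N α (x - y) ∂μ
      ≤ M * ∫ y in Metric.ball (0 : Eucl N) 1, rieszKernel N α y := by
    have hle : μ.restrict (Metric.ball x 1) ≤ M • volume.restrict (Metric.ball x 1) := by
      rw [← Measure.restrict_smul]
      exact Measure.restrict_mono_measure hM _
    refine (integral_mono_measure hle (Eventually.of_forall fun y => rieszKernel_nonneg _)
      (Integrable.smul_measure_nnreal
        (integrableOn_rieszKernel_sub_ball hN hα1 x 1))).trans_eq ?_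
    rw [integral_smul_nnreal_measure, setIntegral_rieszKernel_sub_ball]
    rfl
  have h2 : ∫ y in (Metric.ball x 1)ᶜ, rieszKernel N α (x - y) ∂μ ≤ μ.real Set.univ := by
    calc ∫ y in (Metric.ball x 1)ᶜ, rieszKernel N α (x - y) ∂μ
        ≤ ∫ y in (Metric.ball x 1)ᶜ, 1 ∂μ := by
          refine setIntegral_mono_on hi.integrableOn (integrable_const _).integrableOn
            measurableSet_ball.compl fun y hy => ?_
          rw [Set.mem_compl_iff, Metric.mem_ball, dist_comm, dist_eq_norm, not_lt] at hy
          exact Real.rpow_le_one_of_one_le_of_nonpos hy (by linarith)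
      _ ≤ ∫ y, 1 ∂μ := setIntegral_le_integral (integrable_const _)
          (Eventually.of_forall fun _ => zero_le_one)
      _ = μ.real Set.univ := by simp
  linarith

lemma IsAdmissible.exists_nonneg_eq_one_sub_rieszPot (h : IsAdmissible N α μ)
    (hN : 3 ≤ N) (hα1 : 0 < α) (hα2 : α < 2) (R : ℝ) {ψ : ℝ → ℝ}
    (hψ : Monotone ψ) {L : ℝ} (hL : 0 < L) (hψL : ∀ a b, |ψ a - ψ b| ≤ L * |a - b|)
    (h0 : ∀ t ≤ 0, ψ t = 0) {M : ℝ} (hM : ∀ t, ψ t ≤ M) :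
    ∃ u : Eucl N → ℝ, Continuous u ∧ (∀ x, 0 ≤ u x) ∧
      ∀ x, u x = 1 - rieszPot N α (μ.restrict (Metric.ball 0 R)) (fun y => ψ (u y)) x := by
  have hN' : (3 : ℝ) ≤ N := by exact_mod_cast hN
  set ν := μ.restrict (Metric.ball (0 : Eucl N) R) with hν
  have hadm : IsAdmissible N α ν := h.restrict _
  obtain ⟨D, hD⟩ := h.density_le R
  have hfin : IsFiniteMeasure ν := by
    refine ⟨?_⟩
    have h1 : ν Set.univ = ν (Metric.ball 0 R) := by simp [hν]
    rw [h1]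
    refine (hD _).trans_lt ?_
    rw [Measure.smul_apply]
    exact ENNReal.mul_lt_top ENNReal.coe_lt_top measure_ball_lt_top
  have : Nonempty (Fin N) := ⟨⟨0, by omega⟩⟩
  have hns : NullSingletonClass ν := by
    refine ⟨fun x => le_antisymm ((hD _).trans ?_) zero_le⟩
    rw [Measure.smul_apply, measure_singleton, smul_zero]
  obtain ⟨Λ, hΛ0, hΛ⟩ := hadm.exists_integral_rieszKernel_le hN hα1 hα2 hD
  have hψ0 : ∀ t, 0 ≤ ψ t := fun t => by
    rcases le_total t 0 with ht | ht
    · exact (h0 t ht).ge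
    · exact (h0 0 le_rfl).ge.trans (hψ ht)
  obtain ⟨u, huc, hu⟩ := hadm.exists_eq_one_sub_rieszPot_of_lipschitz hN hα1 hα2 hΛ hΛ0 hψ hL
    hψL hψ0 hM
  refine ⟨u, huc, ?_, hu⟩
  have hM0 : 0 ≤ M := (hψ0 0).trans (hM 0)
  have hψm : Measurable fun y => ψ (u y) := hψ.measurable.comp huc.measurable
  have hψM : ∀ y, |ψ (u y)| ≤ M := fun y => by rw [abs_of_nonneg (hψ0 _)]; exact hM _
  have hpot : ∀ x, |rieszPot N α ν (fun y => ψ (u y)) x| ≤ M * Λ := fun x =>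
    (hadm.abs_rieszPot_le hN hα1 hα2 hψM x).trans (mul_le_mul_of_nonneg_left (hΛ x) hM0)
  obtain ⟨κ, hκ0, hκ⟩ := exists_integral_rieszKernel_mul_fracLap (N := N) hN hα1 hα2
  have hlim : Tendsto (fun t : ℝ => M * (t ^ (-((N : ℝ) - α)) * ν.real Set.univ)) atTop (𝓝 0) := by
    simpa using ((tendsto_rpow_neg_atTop (by linarith : 0 < (N : ℝ) - α)).mul_const
      (ν.real Set.univ)).const_mul M
  obtain ⟨t, ht, ht0⟩ := ((hlim.eventually (gt_mem_nhds one_pos)).and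
    (eventually_gt_atTop (0 : ℝ))).exists
  refine nonneg_of_integral_mul_fracLap_nonpos hN hα1 hα2 huc (C := 1 + M * Λ) (R := R + t)
    (fun x => ?_) (fun x hx => ?_) fun θ hθ hθc hθu => ?_
  · rw [hu x]
    have := abs_le.1 (hpot x)
    rw [abs_le]
    constructor <;> linarith [this.1, this.2]
  · have hk : ∫ y, rieszKernel N α (x - y) ∂ν ≤ t ^ (-((N : ℝ) - α)) * ν.real Set.univ := by
      calc ∫ y, rieszKernel N α (x - y) ∂ν ≤ ∫ y, t ^ (-((N : ℝ) - α)) ∂ν := by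
            refine integral_mono_ae (hadm.integrable hN hα1 hα2 x) (integrable_const _) ?_
            refine ae_restrict_of_forall_mem measurableSet_ball fun y hy => ?_
            rw [mem_ball_zero_iff] at hy
            have hxy : t ≤ ‖x - y‖ := by linarith [norm_sub_norm_le x y]
            rw [neg_sub]
            exact Real.rpow_le_rpow_of_nonpos ht0 hxy (by linarith)
        _ = _ := by simp [mul_comm]
    have h1 := (le_abs_self _).trans (hadm.abs_rieszPot_le hN hα1 hα2 hψM x)
    have h2 := mul_le_mul_of_nonneg_left hk hM0
    rw [hu x]
    linarith
  · have h1 := hadm.integral_one_sub_rieszPot_mul_fracLap hN hα1 hα2 hκ hψm (fun y => hψ0 _)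
      (fun y => hM _) (fun x => (le_abs_self _).trans (hpot x)) hθ hθc
    have h2 : ∀ y, ψ (u y) * θ y = 0 := fun y => by
      by_cases hy : θ y = 0
      · simp [hy]
      · simp [h0 _ (hθu y hy).le]
    simp only [← hu, h2, integral_zero, mul_zero] at h1
    exact h1.le

lemma exists_lipschitz_between_shift {φ : ℝ → ℝ} (hc : Continuous φ) (hm : Monotone φ) {M : ℝ}
    (hM : ∀ t, |φ t| ≤ M) {δ : ℝ} (hδ : 0 < δ) :
    ∃ ψ : ℝ → ℝ, Monotone ψ ∧ (∃ L > 0, ∀ a b, |ψ a - ψ b| ≤ L * |a - b|) ∧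
      ∀ t, φ (t - δ) ≤ ψ t ∧ ψ t ≤ φ t := by
  have hM0 : 0 ≤ M := (abs_nonneg _).trans (hM 0)
  have hi : ∀ t, IntervalIntegrable (fun s => φ (t - δ * s)) volume 0 1 := fun t =>
    (hc.comp (by fun_prop)).intervalIntegrable _ _
  have hi' : ∀ a b, IntervalIntegrable φ volume a b := fun a b => hc.intervalIntegrable _ _
  refine ⟨fun t => ∫ s in (0 : ℝ)..1, φ (t - δ * s), fun a b hab => ?_,
    ⟨δ⁻¹ * (M + M) + 1, by positivity, fun a b => ?_⟩, fun t => ⟨?_, ?_⟩⟩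
  · exact intervalIntegral.integral_mono zero_le_one (hi a) (hi b) fun s => hm (by linarith)
  · have e : ∀ t, ∫ s in (0 : ℝ)..1, φ (t - δ * s) = δ⁻¹ * ∫ s in (t - δ)..t, φ s := fun t => by
      rw [intervalIntegral.integral_comp_sub_mul _ hδ.ne']
      simp
    have e2 : (∫ s in (a - δ)..a, φ s) - ∫ s in (b - δ)..b, φ s
        = (∫ s in b..a, φ s) - ∫ s in (b - δ)..(a - δ), φ s := by
      rw [intervalIntegral.integral_interval_sub_interval_comm (hi' _ _) (hi' _ _) (hi' _ _),
        intervalIntegral.integral_symm, intervalIntegral.integral_symm b a]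
      ring
    have hb : ∀ c d, |∫ s in c..d, φ s| ≤ M * |d - c| := fun c d =>
      intervalIntegral.norm_integral_le_of_norm_le_const (f := φ) (a := c) (b := d)
        fun s _ => hM s
    have h1 := hb b a
    have h2 := hb (b - δ) (a - δ)
    rw [sub_sub_sub_cancel_right] at h2
    beta_reduce
    rw [e, e, ← mul_sub, e2, abs_mul, abs_of_pos (inv_pos.2 hδ)]
    calc δ⁻¹ * |(∫ s in b..a, φ s) - ∫ s in (b - δ)..(a - δ), φ s|
        ≤ δ⁻¹ * (M * |a - b| + M * |a - b|) := by
          gcongr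
          exact (abs_sub _ _).trans (add_le_add h1 h2)
      _ ≤ (δ⁻¹ * (M + M) + 1) * |a - b| := by nlinarith [abs_nonneg (a - b)]
  · have : ∫ s in (0 : ℝ)..1, φ (t - δ) ≤ ∫ s in (0 : ℝ)..1, φ (t - δ * s) :=
      intervalIntegral.integral_mono_on zero_le_one intervalIntegrable_const (hi t)
        fun s hs => hm (by nlinarith [hs.2])
    simpa using this
  · have : ∫ s in (0 : ℝ)..1, φ (t - δ * s) ≤ ∫ s in (0 : ℝ)..1, φ t :=
      intervalIntegral.integral_mono_on zero_le_one (hi t) intervalIntegrable_const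
        fun s hs => hm (by nlinarith [hs.1])
    simpa using this

lemma rieszPot_restrict {s : Set (Eucl N)} (hs : MeasurableSet s) (f : Eucl N → ℝ) (x : Eucl N) :
    rieszPot N α (μ.restrict s) f x = rieszPot N α μ (s.indicator f) x := by
  rw [rieszPot, rieszPot, ← integral_indicator hs]
  simp only [Set.indicator_mul_right]

/-- Solvability of the integral equation `u = 1 - Φ ∗ (φ(u) μ)`. -/
lemma IsAdmissible.exists_eq_one_sub_rieszPot (h : IsAdmissible N α μ)
    (hN : 3 ≤ N) (hα1 : 0 < α) (hα2 : α < 2) {φ : ℝ → ℝ} (hφc : Continuous φ)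
    (hφm : Monotone φ) (hφ0 : ∀ t ≤ 0, φ t = 0) {M : ℝ} (hM : ∀ t, φ t ≤ M) :
    ∃ u : Eucl N → ℝ, Continuous u ∧ (∀ x, 0 ≤ u x) ∧
      ∀ x, u x = 1 - rieszPot N α μ (fun y => φ (u y)) x := by
  have hφnn : ∀ t, 0 ≤ φ t := fun t => by
    rcases le_total t 0 with ht | ht
    · exact (hφ0 t ht).ge
    · exact (hφ0 0 le_rfl).ge.trans (hφm ht)
  have hφM : ∀ t, |φ t| ≤ M := fun t => by rw [abs_of_nonneg (hφnn _)]; exact hM t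
  have happ : ∀ n : ℕ, ∃ ψ : ℝ → ℝ, Monotone ψ ∧ (∃ L > 0, ∀ a b, |ψ a - ψ b| ≤ L * |a - b|) ∧
      ∀ t, φ (t - 1 / ((n : ℝ) + 1)) ≤ ψ t ∧ ψ t ≤ φ t := fun n =>
    exists_lipschitz_between_shift hφc hφm hφM (by positivity)
  choose ψ hψm hψL hψφ using happ
  have hψ0 : ∀ n t, 0 ≤ ψ n t := fun n t => (hφnn _).trans (hψφ n t).1
  have hsol : ∀ n : ℕ, ∃ u : Eucl N → ℝ, Continuous u ∧ (∀ x, 0 ≤ u x) ∧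
      ∀ x, u x = 1 - rieszPot N α (μ.restrict (Metric.ball 0 n)) (fun y => ψ n (u y)) x :=
    fun n => by
      obtain ⟨L, hL, hLip⟩ := hψL n
      exact h.exists_nonneg_eq_one_sub_rieszPot hN hα1 hα2 n (hψm n) hL hLip
        (fun t ht => le_antisymm ((hψφ n t).2.trans (hφ0 t ht).le) (hψ0 n t))
        (fun t => (hψφ n t).2.trans (hM t))
  choose u huc hu0 hu using hsol
  set f : ℕ → Eucl N → ℝ := fun n => (Metric.ball 0 (n : ℝ)).indicator fun y => ψ n (u n y) with hf
  have hfm : ∀ n, Measurable (f n) := fun n =>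
    ((hψm n).measurable.comp (huc n).measurable).indicator measurableSet_ball
  have hfM : ∀ n x, |f n x| ≤ M := fun n x => by
    have h1 : 0 ≤ f n x := Set.indicator_nonneg (fun y _ => hψ0 n _) x
    rw [abs_of_nonneg h1]
    exact Set.indicator_le' (g := fun _ => M) (fun y _ => (hψφ n _).2.trans (hM _))
      (fun _ _ => (hφnn 0).trans (hM 0)) x
  have huf : ∀ n x, u n x = 1 - rieszPot N α μ (f n) x := fun n x => by
    rw [hu n x, rieszPot_restrict measurableSet_ball]
  obtain ⟨s, hs, p, hp⟩ := h.exists_subseq_tendsto hN hα1 hα2 hfm hfM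
  set w : Eucl N → ℝ := fun x => 1 - p x with hw
  have huw : ∀ x, Tendsto (fun k => u (s k) x) atTop (𝓝 (w x)) := fun x => by
    simp only [huf]
    exact (hp x).const_sub 1
  have hwm : Measurable w := measurable_of_tendsto_metrizable
    (fun k => (huc (s k)).measurable) (tendsto_pi_nhds.2 huw)
  have hfw : ∀ x, Tendsto (fun k => f (s k) x) atTop (𝓝 (φ (w x))) := fun x => by
    have hup : Tendsto (fun k => φ (u (s k) x)) atTop (𝓝 (φ (w x))) :=
      (hφc.tendsto _).comp (huw x)
    have hlo : Tendsto (fun k => φ (u (s k) x - 1 / ((s k : ℝ) + 1))) atTop (𝓝 (φ (w x))) := by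
      have h1 := (huw x).sub (tendsto_one_div_add_atTop_nhds_zero_nat.comp hs.tendsto_atTop)
      rw [sub_zero] at h1
      exact (hφc.tendsto _).comp h1
    have h2 : Tendsto (fun k => ψ (s k) (u (s k) x)) atTop (𝓝 (φ (w x))) :=
      tendsto_of_tendsto_of_tendsto_of_le_of_le hlo hup (fun k => (hψφ _ _).1)
        fun k => (hψφ _ _).2
    refine h2.congr' ?_
    filter_upwards [(tendsto_natCast_atTop_atTop.comp hs.tendsto_atTop).eventually_gt_atTop ‖x‖]
      with k hk
    have hx : x ∈ Metric.ball (0 : Eucl N) (s k : ℝ) := by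
      rw [mem_ball_zero_iff]
      exact hk
    exact (Set.indicator_of_mem hx fun y => ψ (s k) (u (s k) y)).symm
  have hwe : ∀ x, w x = 1 - rieszPot N α μ (fun y => φ (w y)) x := fun x => by
    rw [hw]
    exact congrArg (fun t => 1 - t)
      (tendsto_nhds_unique (hp x) (h.tendsto_rieszPot hN hα1 hα2 (fun k => hfm (s k))
        (fun k => hfM (s k)) hfw x))
  refine ⟨w, ?_, fun x => ge_of_tendsto (huw x) (Eventually.of_forall fun k => hu0 _ _), hwe⟩
  rw [funext hwe]
  exact continuous_const.sub
    (h.continuous_rieszPot hN hα1 hα2 (hφc.measurable.comp hwm) fun x => hφM _)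

end Existence

section Density

open scoped NNReal

variable {N : ℕ} {α : ℝ}

lemma isAdmissible_withDensity {g : Eucl N → ℝ≥0} (hg : Measurable g)
    (hb : ∀ R : ℝ, ∃ M : ℝ≥0, ∀ x, ‖x‖ ≤ R → g x ≤ M) {x₀ : Eucl N}
    (hi : Integrable fun y => (g y : ℝ) * rieszKernel N α (x₀ - y)) :
    IsAdmissible N α (volume.withDensity fun x => (g x : ENNReal)) where
  density_le R := by
    obtain ⟨M, hM⟩ := hb R
    refine ⟨M, ?_⟩
    rw [restrict_withDensity measurableSet_ball]
    calc (volume.restrict (Metric.ball 0 R)).withDensity (fun x => (g x : ENNReal))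
        ≤ (volume.restrict (Metric.ball 0 R)).withDensity (fun _ => (M : ENNReal)) := by
          refine withDensity_mono (ae_restrict_of_forall_mem measurableSet_ball fun x hx => ?_)
          rw [mem_ball_zero_iff] at hx
          exact ENNReal.coe_le_coe.2 (hM x hx.le)
      _ = (M : ENNReal) • volume.restrict (Metric.ball 0 R) := withDensity_const _
      _ ≤ (M : ENNReal) • volume := by
          gcongr
          exact Measure.restrict_le_self
  exists_integrable := ⟨x₀, (integrable_withDensity_iff_integrable_smul hg).2 hi⟩

end Density

/-- if the Riesz potential of `ρ` is finite at some point, then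
`Δ^{α/2}u = ρ·φ(u)` has a nontrivial nonnegative entire bounded solution. -/
theorem stmt6 (N : ℕ) (hN : 3 ≤ N) (α : ℝ) (hα1 : 0 < α) (hα2 : α < 2)
    (ρ : EuclideanSpace ℝ (Fin N) → ℝ) (hρm : Measurable ρ) (hρnn : ∀ x, 0 ≤ ρ x)
    (hρlb : ∀ R : ℝ, ∃ M : ℝ, ∀ x : EuclideanSpace ℝ (Fin N), ‖x‖ ≤ R → ρ x ≤ M)
    (φ : ℝ → ℝ) (hφc : ContinuousOn φ (Set.Ici 0)) (hφm : MonotoneOn φ (Set.Ici 0))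
    (hφ0 : φ 0 = 0) (hφnn : ∀ t : ℝ, 0 ≤ t → 0 ≤ φ t)
    (hpot : ∃ x₀ : EuclideanSpace ℝ (Fin N),
      Integrable (fun y => ρ y * ‖x₀ - y‖ ^ (-((N : ℝ) - α)))) :
    ∃ u : EuclideanSpace ℝ (Fin N) → ℝ,
      IsEntireSol N α ρ φ u ∧ ∃ x, u x ≠ 0 := by
  obtain ⟨κ, hκ0, hκ⟩ := exists_integral_rieszKernel_mul_fracLap (N := N) hN hα1 hα2
  obtain ⟨x₀, hx₀⟩ := hpot
  set g : Eucl N → NNReal := fun x => (κ⁻¹ * ρ x).toNNReal with hg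
  have hgρ : ∀ x, (g x : ℝ) = κ⁻¹ * ρ x := fun x =>
    Real.coe_toNNReal _ (mul_nonneg (inv_nonneg.2 hκ0.le) (hρnn x))
  have hgm : Measurable g := (hρm.const_mul _).real_toNNReal
  set μ : Measure (Eucl N) := volume.withDensity fun x => (g x : ENNReal) with hμ
  have hadm : IsAdmissible N α μ := by
    refine isAdmissible_withDensity (x₀ := x₀) hgm (fun R => ?_) ?_
    · obtain ⟨M, hM⟩ := hρlb R
      refine ⟨(κ⁻¹ * M).toNNReal, fun x hx => Real.toNNReal_mono ?_⟩
      exact mul_le_mul_of_nonneg_left (hM x hx) (inv_nonneg.2 hκ0.le)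
    · refine (hx₀.const_mul κ⁻¹).congr (Eventually.of_forall fun y => ?_)
      simp only [hgρ, rieszKernel, neg_sub]
      ring
  set P : ℝ → ℝ := fun t => max 0 (min t 1) with hP
  have hPc : Continuous P := by fun_prop
  have hP0 : ∀ t, P t ∈ Set.Ici (0 : ℝ) := fun t => Set.mem_Ici.2 (le_max_left _ _)
  have hPm : Monotone P := fun a b hab => max_le_max le_rfl (min_le_min hab le_rfl)
  have hP1 : ∀ t, P t ≤ 1 := fun t => max_le zero_le_one (min_le_right _ _)
  set ψ : ℝ → ℝ := fun t => φ (P t) with hψ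
  have hψc : Continuous ψ := hφc.comp_continuous hPc hP0
  have hψm : Monotone ψ := fun a b hab => hφm (hP0 a) (hP0 b) (hPm hab)
  have hψ0 : ∀ t ≤ 0, ψ t = 0 := fun t ht => by
    simp only [hψ, hP]
    rw [max_eq_left ((min_le_left _ _).trans ht), hφ0]
  have hψnn : ∀ t, 0 ≤ ψ t := fun t => hφnn _ (hP0 t)
  have hψM : ∀ t, ψ t ≤ φ 1 := fun t => hφm (hP0 t) (Set.mem_Ici.2 zero_le_one) (hP1 t)
  obtain ⟨u, huc, hu0, hu⟩ := hadm.exists_eq_one_sub_rieszPot hN hα1 hα2 hψc hψm hψ0 hψM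
  have hpot0 : ∀ x, 0 ≤ rieszPot N α μ (fun y => ψ (u y)) x := fun x =>
    integral_nonneg fun y => mul_nonneg (rieszKernel_nonneg _) (hψnn _)
  have hu1 : ∀ x, u x ≤ 1 := fun x => by rw [hu x]; linarith [hpot0 x]
  have hψu : ∀ x, ψ (u x) = φ (u x) := fun x => by
    simp only [hψ, hP]
    rw [min_eq_left (hu1 x), max_eq_right (hu0 x)]
  have hψum : Measurable fun x => ψ (u x) := (hψc.comp huc).measurable
  refine ⟨u, ⟨huc, ⟨1, hu1⟩, hu0, ?_, fun θ hθ hc => ?_⟩, ?_⟩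
  · simp only [← hψu]
    refine (locallyIntegrable_iff).2 fun k hk => ?_
    obtain ⟨R, hR⟩ := hk.isBounded.exists_norm_le
    obtain ⟨M, hM⟩ := hρlb R
    refine Measure.integrableOn_of_bounded (M := M * φ 1) hk.measure_lt_top.ne
      (hρm.mul hψum).aestronglyMeasurable
      (ae_restrict_of_forall_mem hk.measurableSet fun x hx => ?_)
    rw [Real.norm_of_nonneg (mul_nonneg (hρnn x) (hψnn _))]
    exact mul_le_mul (hM x (hR x hx)) (hψM _) (hψnn _) ((hρnn x).trans (hM x (hR x hx)))
  · have h1 := hadm.integral_one_sub_rieszPot_mul_fracLap hN hα1 hα2 hκ hψum (fun y => hψnn _)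
      (fun y => hψM _) (B := 1) (fun x => by linarith [hu x, hu0 x]) hθ hc
    simp only [← hu] at h1
    rw [h1, hμ, integral_withDensity_eq_integral_smul hgm, ← integral_const_mul]
    congr 1
    ext x
    rw [NNReal.smul_def, hgρ, hψu, smul_eq_mul]
    field_simp
  · by_contra! hz
    have h1 := hu 0
    have h2 : ∀ y, ψ (u y) = 0 := fun y => hψ0 _ (hz y).le
    simp [rieszPot, h2, hz 0] at h1
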